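/- For every Sophie Germain prime g ≥ 5 there exist a prime number p and integers x, y such that p = x² + (2g+1)y², p ≠ 2g+1, and p is not congruent to 1 modulo 2g+1. -/

import Mathlib

open Filter Topology

/-- The quadratic order `ℤ[ω]` with `ω² = ω - m`, of discriminant `1 - 4 * m`. -/
abbrev QuadOrder (m : ℤ) := QuadraticAlgebra ℤ (-m) 1

namespace QuadOrder

open QuadraticAlgebra

local notation "𝒩" => QuadraticAlgebra.norm

variable {m : ℤ}

theorem nm_eq (z : QuadOrder m) : 𝒩 z = z.re ^ 2 + z.re * z.im + m * z.im ^ 2 := by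
  rw [norm_def]; ring

theorem four_mul_nm (z : QuadOrder m) :
    4 * 𝒩 z = (2 * z.re + z.im) ^ 2 + (4 * m - 1) * z.im ^ 2 := by
  rw [nm_eq]; ring

theorem nm_nonneg (hm : 0 < m) (z : QuadOrder m) : 0 ≤ 𝒩 z := by
  have h := four_mul_nm z
  nlinarith [sq_nonneg (2 * z.re + z.im), mul_nonneg (by linarith : 0 ≤ 4 * m - 1) (sq_nonneg z.im)]

theorem nm_eq_zero_iff (hm : 0 < m) {z : QuadOrder m} : 𝒩 z = 0 ↔ z = 0 := by
  refine ⟨fun h => ?_, fun h => by simp [h]⟩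
  have h4 := four_mul_nm z
  rw [h] at h4
  have hp : 0 < 4 * m - 1 := by linarith
  have him : z.im = 0 := by
    by_contra hne
    have : 0 < z.im ^ 2 := by positivity
    nlinarith [sq_nonneg (2 * z.re + z.im)]
  have hre : z.re = 0 := by
    rw [him] at h4
    nlinarith [sq_nonneg z.re]
  ext <;> simp [him, hre]

theorem nm_pos (hm : 0 < m) {z : QuadOrder m} (hz : z ≠ 0) : 0 < 𝒩 z :=
  lt_of_le_of_ne (nm_nonneg hm z) fun h => hz ((nm_eq_zero_iff hm).1 h.symm)

theorem isDomain (hm : 0 < m) : IsDomain (QuadOrder m) :=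
  have : NoZeroDivisors (QuadOrder m) := ⟨fun {a b} h => by
    have h2 : 𝒩 a * 𝒩 b = 0 := by rw [← map_mul, h, QuadraticAlgebra.norm_zero]
    rcases mul_eq_zero.1 h2 with h3 | h3
    · exact Or.inl ((nm_eq_zero_iff hm).1 h3)
    · exact Or.inr ((nm_eq_zero_iff hm).1 h3)⟩
  NoZeroDivisors.to_isDomain _

/-- The inclusion of the order into its fraction field. -/
def toRat (m : ℤ) : QuadOrder m →+* QuadraticAlgebra ℚ (-(m : ℚ)) 1 where
  toFun z := ⟨z.re, z.im⟩
  map_one' := by ext <;> simp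
  map_mul' x y := by ext <;> simp
  map_zero' := by ext <;> simp
  map_add' x y := by ext <;> simp

theorem toRat_injective : Function.Injective (toRat m) := fun x y h => by
  have h1 : (x.re : ℚ) = y.re := congrArg QuadraticAlgebra.re h
  have h2 : (x.im : ℚ) = y.im := congrArg QuadraticAlgebra.im h
  ext
  · exact_mod_cast h1
  · exact_mod_cast h2

theorem exists_int_of_isIntegral {r : ℚ} (h : IsIntegral ℤ r) : ∃ k : ℤ, r = k := by
  obtain ⟨k, hk⟩ := IsIntegrallyClosed.isIntegral_iff.1 h
  exact ⟨k, by simpa using hk.symm⟩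

theorem exists_int_of_prime_mul_sq {q : ℤ} (hq : Prime q) {b : ℚ} {k : ℤ}
    (h : (q : ℚ) * b ^ 2 = k) : ∃ d : ℤ, b = d := by
  have hq0 : (q : ℚ) ≠ 0 := by exact_mod_cast hq.ne_zero
  have h1 : IsIntegral ℤ (q * b : ℚ) := by
    refine IsIntegral.of_pow (n := 2) two_pos ?_
    have : (q * b : ℚ) ^ 2 = ((q * k : ℤ) : ℚ) := by push_cast; rw [← h]; ring
    rw [this]
    exact isIntegral_algebraMap (R := ℤ) (A := ℚ)
  obtain ⟨c, hc⟩ := exists_int_of_isIntegral h1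
  have h2 : c ^ 2 = q * k := by
    have : (c : ℚ) ^ 2 = q * k := by rw [← hc, ← h]; ring
    exact_mod_cast this
  obtain ⟨d, rfl⟩ := hq.dvd_of_dvd_pow ⟨k, h2⟩
  refine ⟨d, ?_⟩
  push_cast at hc
  exact mul_left_cancel₀ hq0 hc

theorem mem_range_toRat_of_isIntegral (hq : Prime (4 * m - 1))
    {z : QuadraticAlgebra ℚ (-(m : ℚ)) 1} (hz : IsIntegral ℤ z) : ∃ y, toRat m y = z := by
  have hs : IsIntegral ℤ (star z) :=
    map_isIntegral_int (starRingEnd (QuadraticAlgebra ℚ (-(m : ℚ)) 1)) hz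
  have hinj : Function.Injective (algebraMap ℚ (QuadraticAlgebra ℚ (-(m : ℚ)) 1)) :=
    algebraMap_injective
  have h1 : IsIntegral ℤ (trace z) := by
    have := hz.add hs
    rw [← algebraMap_trace_eq_add_star] at this
    exact (isIntegral_algebraMap_iff hinj).1 this
  have h2 : IsIntegral ℤ (𝒩 z) := by
    have := hz.mul hs
    rw [← algebraMap_norm_eq_mul_star] at this
    exact (isIntegral_algebraMap_iff hinj).1 this
  obtain ⟨T, hT⟩ := exists_int_of_isIntegral h1
  obtain ⟨N, hN⟩ := exists_int_of_isIntegral h2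
  rw [trace_def] at hT
  rw [norm_def] at hN
  obtain ⟨d, hd⟩ := exists_int_of_prime_mul_sq hq (b := z.im) (k := 4 * N - T ^ 2) (by
    push_cast
    rw [← hT, ← hN]; ring)
  have h3 : T ^ 2 + (4 * m - 1) * d ^ 2 = 4 * N := by
    have : (T : ℚ) ^ 2 + (4 * m - 1) * d ^ 2 = 4 * N := by
      rw [← hT, ← hN, ← hd]; ring
    exact_mod_cast this
  have h4 : Even (T - d) := by
    have : (T - d) * (T + d) = 4 * (N - m * d ^ 2) := by linear_combination h3
    have h5 : Even ((T - d) * (T + d)) := ⟨2 * (N - m * d ^ 2), by rw [this]; ring⟩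
    rcases Int.even_mul.1 h5 with h | h
    · exact h
    · obtain ⟨k, hk⟩ := h
      exact ⟨k - d, by linarith⟩
  obtain ⟨a, ha⟩ := h4
  refine ⟨⟨a, d⟩, ?_⟩
  ext
  · have : (T : ℚ) - d = a + a := by exact_mod_cast ha
    simp only [toRat, RingHom.coe_mk, MonoidHom.coe_mk, OneHom.coe_mk]
    rw [← hT, ← hd] at this
    linarith
  · exact hd.symm

theorem isDedekindDomain (hm : 0 < m) (hq : Prime (4 * m - 1)) :
    IsDedekindDomain (QuadOrder m) := by
  have := isDomain hm
  have : Fact (∀ r : ℚ, r ^ 2 ≠ -(m : ℚ) + 1 * r) := ⟨fun r h => by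
    have : (1 : ℚ) ≤ m := by exact_mod_cast hm
    nlinarith [sq_nonneg (2 * r - 1)]⟩
  let L := QuadraticAlgebra ℚ (-(m : ℚ)) 1
  let : Algebra (QuadOrder m) L := (toRat m).toAlgebra
  have : IsScalarTower ℤ (QuadOrder m) L := inferInstance
  have : IsIntegralClosure (QuadOrder m) ℤ L := ⟨toRat_injective, fun {x} =>
    ⟨fun h => mem_range_toRat_of_isIntegral hq h, by
    rintro ⟨y, rfl⟩
    exact (Algebra.IsIntegral.isIntegral (R := ℤ) y).algebraMap⟩⟩
  exact IsIntegralClosure.isDedekindDomain ℤ ℚ L (QuadOrder m)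

theorem absNorm_span_singleton [IsDedekindDomain (QuadOrder m)] (hm : 0 < m) (z : QuadOrder m) :
    (Ideal.absNorm (Ideal.span {z}) : ℤ) = 𝒩 z := by
  rw [Ideal.absNorm_span_singleton]
  have : Algebra.norm ℤ z = 𝒩 z := by
    rw [Algebra.norm_apply, ← det_toLinearMap_eq_norm]
    rfl
  rw [this, Int.natAbs_of_nonneg (nm_nonneg hm z)]

end QuadOrder

/-- A function on the reals that extends, to the right of `1`, to a function which is complex
differentiable at `1`. -/
def RegularAtOne (f : ℝ → ℂ) : Prop :=
  ∃ F : ℂ → ℂ, DifferentiableAt ℂ F 1 ∧ ∀ᶠ s : ℝ in 𝓝[>] 1, f s = F s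

namespace RegularAtOne

theorem congr {f g : ℝ → ℂ} (hf : RegularAtOne f) (h : ∀ᶠ s : ℝ in 𝓝[>] 1, g s = f s) :
    RegularAtOne g := by
  obtain ⟨F, hF, hfF⟩ := hf
  exact ⟨F, hF, by filter_upwards [h, hfF] with s h1 h2 using h1.trans h2⟩

theorem const (c : ℂ) : RegularAtOne fun _ => c :=
  ⟨fun _ => c, by fun_prop, by simp⟩

theorem add {f g : ℝ → ℂ} (hf : RegularAtOne f) (hg : RegularAtOne g) :
    RegularAtOne fun s => f s + g s := by
  obtain ⟨F, hF, hfF⟩ := hf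
  obtain ⟨G, hG, hgG⟩ := hg
  exact ⟨fun s => F s + G s, hF.fun_add hG, by
    filter_upwards [hfF, hgG] with s h1 h2; rw [h1, h2]⟩

theorem mul {f g : ℝ → ℂ} (hf : RegularAtOne f) (hg : RegularAtOne g) :
    RegularAtOne fun s => f s * g s := by
  obtain ⟨F, hF, hfF⟩ := hf
  obtain ⟨G, hG, hgG⟩ := hg
  exact ⟨fun s => F s * G s, hF.fun_mul hG, by
    filter_upwards [hfF, hgG] with s h1 h2; rw [h1, h2]⟩

theorem sum {ι : Type*} {f : ι → ℝ → ℂ} (t : Finset ι) (hf : ∀ i ∈ t, RegularAtOne (f i)) :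
    RegularAtOne fun s => ∑ i ∈ t, f i s := by
  classical
  induction t using Finset.induction_on with
  | empty => simpa using const 0
  | insert i t hi ih =>
    simp only [Finset.sum_insert hi]
    exact (hf i (by simp)).add (ih fun j hj => hf j (by simp [hj]))

theorem rpow_sub_one {n : ℝ} (hn : 0 < n) : RegularAtOne fun s => ((n ^ (s - 1) : ℝ) : ℂ) := by
  refine ⟨fun s => (n : ℂ) ^ (s - 1), ?_, Eventually.of_forall fun s => ?_⟩
  · have : (n : ℂ) ≠ 0 := by exact_mod_cast hn.ne'
    exact DifferentiableAt.const_cpow (by fun_prop) (Or.inl this)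
  · beta_reduce
    rw [Complex.ofReal_cpow hn.le]; push_cast; rfl

end RegularAtOne

namespace QuadOrder

open QuadraticAlgebra (linearEquivTuple linearEquivTuple_apply)

local notation "𝒩" => QuadraticAlgebra.norm

variable {m : ℤ}

/-- The complex embedding of the order. -/
noncomputable def emb (z : QuadOrder m) : ℂ :=
  ⟨z.re + z.im / 2, z.im * √(4 * m - 1) / 2⟩

theorem emb_sub (z w : QuadOrder m) : emb (z - w) = emb z - emb w := by
  apply Complex.ext <;> simp [emb] <;> ring

theorem norm_emb_sq (hm : 0 < m) (z : QuadOrder m) : ‖emb z‖ ^ 2 = ((𝒩 z : ℤ) : ℝ) := by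
  have h1 : (1 : ℝ) ≤ m := by exact_mod_cast hm
  have h2 : √(4 * (m : ℝ) - 1) ^ 2 = 4 * m - 1 := Real.sq_sqrt (by linarith)
  rw [Complex.sq_norm, Complex.normSq_apply, nm_eq]
  simp only [emb]
  push_cast
  linear_combination (z.im : ℝ) ^ 2 / 4 * h2

theorem one_le_nm (hm : 0 < m) {z : QuadOrder m} (hz : z ≠ 0) : (1 : ℝ) ≤ ((𝒩 z : ℤ) : ℝ) := by
  exact_mod_cast nm_pos hm hz

theorem summable_norm_rpow (hm : 0 < m) {s : ℝ} (hs : 1 < s) :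
    Summable fun z : QuadOrder m => ((𝒩 z : ℤ) : ℝ) ^ (-s) := by
  have h := EisensteinSeries.summable_one_div_norm_rpow (k := 2 * s) (by linarith)
  have h1 := (h.comp_injective (linearEquivTuple (-m) (1 : ℤ)).injective).mul_left (16 ^ s : ℝ)
  refine Summable.of_nonneg_of_le (fun z => ?_) (fun z => ?_) h1
  · exact Real.rpow_nonneg (by exact_mod_cast nm_nonneg hm z) _
  · by_cases hz : z = 0
    · subst hz
      simp only [QuadraticAlgebra.norm_zero, Int.cast_zero]
      rw [Real.zero_rpow (by linarith)]
      simp only [Function.comp]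
      positivity
    simp only [Function.comp, linearEquivTuple_apply]
    have hN := one_le_nm hm hz
    set x : Fin 2 → ℤ := ![z.re, z.im] with hx
    have hx0 : 0 < ‖x‖ := by
      rw [norm_pos_iff]
      intro h0
      apply hz
      ext
      · simpa [hx] using congrFun h0 0
      · simpa [hx] using congrFun h0 1
    have h1m : (1 : ℝ) ≤ m := by exact_mod_cast hm
    have h4 : 4 * ((𝒩 z : ℤ) : ℝ) = (2 * z.re + z.im) ^ 2 + (4 * m - 1) * z.im ^ 2 := by
      exact_mod_cast four_mul_nm z
    have him : (z.im : ℝ) ^ 2 ≤ 16 * 𝒩 z := by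
      nlinarith [sq_nonneg (2 * (z.re : ℝ) + z.im), sq_nonneg (z.im : ℝ)]
    have hre : (z.re : ℝ) ^ 2 ≤ 16 * 𝒩 z := by
      nlinarith [sq_nonneg (2 * (z.re : ℝ) + 2 * z.im), sq_nonneg (z.im : ℝ)]
    have hxle : ‖x‖ ≤ √(16 * 𝒩 z) := by
      rw [pi_norm_le_iff_of_nonneg (Real.sqrt_nonneg _)]
      intro i
      apply Real.le_sqrt_of_sq_le
      fin_cases i
      · simpa [hx, Int.norm_eq_abs] using hre
      · simpa [hx, Int.norm_eq_abs] using him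
    have h5 : ‖x‖ ^ 2 ≤ 16 * 𝒩 z := by
      calc ‖x‖ ^ 2 ≤ √(16 * 𝒩 z) ^ 2 := by gcongr
        _ = _ := Real.sq_sqrt (by linarith)
    have h6 : ‖x‖ ^ (-(2 * s)) = (‖x‖ ^ 2) ^ (-s) := by
      rw [← Real.rpow_natCast, ← Real.rpow_mul hx0.le]; norm_num
    rw [h6]
    calc ((𝒩 z : ℤ) : ℝ) ^ (-s) = 16 ^ s * (16 * ((𝒩 z : ℤ) : ℝ)) ^ (-s) := by
          rw [Real.mul_rpow (by norm_num) (by linarith), ← mul_assoc,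
            ← Real.rpow_add (by norm_num)]
          simp
      _ ≤ _ := by
          gcongr ?_ * ?_
          exact Real.rpow_le_rpow_of_nonpos (by positivity) h5 (by linarith)

theorem norm_cpow_sub_cpow_le {a b c : ℝ} (hc : 0 < c) (ha : c ≤ a) (hb : c ≤ b) {s : ℂ}
    (hs : 0 < s.re) :
    ‖(a : ℂ) ^ (-s) - (b : ℂ) ^ (-s)‖ ≤ ‖s‖ * c ^ (-s.re - 1) * |a - b| := by
  have hne : s ≠ 0 := fun h => by simp [h] at hs
  have hd : ∀ x ∈ Set.Ici c, HasDerivWithinAt (fun t : ℝ => (t : ℂ) ^ (-s))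
      (-s * (x : ℂ) ^ (-s - 1)) (Set.Ici c) x := fun x hx =>
    (hasDerivAt_ofReal_cpow_const' (r := -s - 1) (hc.trans_le hx).ne' (by simp [hne])
      |>.const_mul (-s)).hasDerivWithinAt.congr_deriv (by ring) |>.congr
      (fun y hy => by
        rw [sub_add_cancel]
        field_simp) (by rw [sub_add_cancel]; field_simp)
  have := (convex_Ici c).norm_image_sub_le_of_norm_hasDerivWithin_le (C := ‖s‖ * c ^ (-s.re - 1))
    hd (fun x hx => by
      rw [norm_mul, norm_neg, Complex.norm_cpow_eq_rpow_re_of_pos (hc.trans_le hx)]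
      gcongr
      simp only [Complex.sub_re, Complex.neg_re, Complex.one_re]
      exact Real.rpow_le_rpow_of_nonpos hc hx (by linarith)) hb ha
  simpa [Real.norm_eq_abs] using this

/-- The region in which shifted 𝒩 series are compared. -/
def shiftRegion : Set ℂ := {s | 3 / 4 < s.re} ∩ Metric.ball 0 3

theorem norm_norm_cpow_le_one (hm : 0 < m) (z : QuadOrder m) {s : ℂ} (hs : 0 < s.re) :
    ‖((𝒩 z : ℤ) : ℂ) ^ (-s)‖ ≤ 1 := by
  have hne : s ≠ 0 := fun h => by simp [h] at hs
  by_cases hz : z = 0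
  · simp [hz, hne]
  · have h := one_le_nm hm hz
    have : ((𝒩 z : ℤ) : ℂ) = (((𝒩 z : ℤ) : ℝ) : ℂ) := by push_cast; rfl
    rw [this, Complex.norm_cpow_eq_rpow_re_of_pos (by linarith)]
    exact Real.rpow_le_one_of_one_le_of_nonpos h (by simp; linarith)

theorem exists_shift_bound (hm : 0 < m) (w : QuadOrder m) : ∃ C : ℝ, 0 ≤ C ∧ ∀ z : QuadOrder m,
    ∀ s ∈ shiftRegion,
    ‖((𝒩 z : ℤ) : ℂ) ^ (-s) - ((𝒩 (z - w) : ℤ) : ℂ) ^ (-s)‖ ≤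
      (if z = 0 then 2 else 0) + C * ((𝒩 z : ℤ) : ℝ) ^ (-(5 / 4) : ℝ) := by
  have hw0 : (0 : ℝ) ≤ 𝒩 w := by exact_mod_cast nm_nonneg hm w
  refine ⟨2 * (4 * ((𝒩 w : ℤ) : ℝ)) ^ (5 / 4 : ℝ) + 3 * 4 ^ (4 : ℝ) * (3 * ‖emb w‖), by positivity,
    fun z s ⟨hs1, hs2⟩ => ?_⟩
  have hs1 : 3 / 4 < s.re := hs1
  have hs2 : ‖s‖ < 3 := by simpa using hs2
  have hs3 : s.re < 3 := (Complex.re_le_norm s).trans_lt hs2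
  have htriv : ‖((𝒩 z : ℤ) : ℂ) ^ (-s) - ((𝒩 (z - w) : ℤ) : ℂ) ^ (-s)‖ ≤ 2 :=
    (norm_sub_le _ _).trans (by
      linarith [norm_norm_cpow_le_one hm z (s := s) (by linarith),
        norm_norm_cpow_le_one hm (z - w) (s := s) (by linarith)])
  by_cases hz : z = 0
  · rw [if_pos hz]
    refine htriv.trans (le_add_of_nonneg_right ?_)
    have : (0 : ℝ) ≤ 𝒩 z := by exact_mod_cast nm_nonneg hm z
    positivity
  rw [if_neg hz, zero_add]
  have hz1 := one_le_nm hm hz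
  have hpos : (0 : ℝ) < 𝒩 z := by linarith
  by_cases hlt : ((𝒩 z : ℤ) : ℝ) < 4 * 𝒩 w
  · refine htriv.trans ?_
    have h1 : (1 : ℝ) ≤ (4 * ((𝒩 w : ℤ) : ℝ)) ^ (5 / 4 : ℝ) * ((𝒩 z : ℤ) : ℝ) ^ (-(5 / 4) : ℝ) := by
      rw [Real.rpow_neg hpos.le, ← div_eq_mul_inv, one_le_div (by positivity)]
      exact Real.rpow_le_rpow hpos.le hlt.le (by norm_num)
    rw [add_mul]
    have : 0 ≤ 3 * 4 ^ (4 : ℝ) * (3 * ‖emb w‖) * ((𝒩 z : ℤ) : ℝ) ^ (-(5 / 4) : ℝ) := by positivity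
    nlinarith
  · push Not at hlt
    have e1 := norm_emb_sq hm z
    have e2 := norm_emb_sq hm w
    have e3 := norm_emb_sq hm (z - w)
    rw [emb_sub] at e3
    have hwz : 2 * ‖emb w‖ ≤ ‖emb z‖ := by
      apply le_of_sq_le_sq _ (norm_nonneg _)
      rw [mul_pow, e1, e2]; linarith
    have t1 : ‖emb z‖ - ‖emb w‖ ≤ ‖emb z - emb w‖ := norm_sub_norm_le _ _
    have t2 : ‖emb z - emb w‖ ≤ ‖emb z‖ + ‖emb w‖ := norm_sub_le _ _
    have hb : ((𝒩 z : ℤ) : ℝ) / 4 ≤ ((𝒩 (z - w) : ℤ) : ℝ) := by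
      rw [← e1, ← e3]
      nlinarith [norm_nonneg (emb z), norm_nonneg (emb w)]
    have h := norm_cpow_sub_cpow_le (a := ((𝒩 z : ℤ) : ℝ)) (b := ((𝒩 (z - w) : ℤ) : ℝ))
      (c := ((𝒩 z : ℤ) : ℝ) / 4)
      (by linarith) (by linarith) hb (s := s) (by linarith)
    have hab : |((𝒩 z : ℤ) : ℝ) - 𝒩 (z - w)| ≤ 3 * ‖emb w‖ * ((𝒩 z : ℤ) : ℝ) ^ (1 / 2 : ℝ) := by
      have : ((𝒩 z : ℤ) : ℝ) ^ (1 / 2 : ℝ) = ‖emb z‖ := by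
        rw [← e1, ← Real.sqrt_eq_rpow, Real.sqrt_sq (norm_nonneg _)]
      rw [this, ← e1, ← e3, abs_le]
      constructor <;> nlinarith [norm_nonneg (emb z), norm_nonneg (emb w)]
    have hc : (((𝒩 z : ℤ) : ℝ) / 4) ^ (-s.re - 1) ≤
        4 ^ (4 : ℝ) * ((𝒩 z : ℤ) : ℝ) ^ (-(7 / 4) : ℝ) := by
      rw [div_eq_mul_inv, Real.mul_rpow hpos.le (by norm_num), mul_comm,
        Real.inv_rpow (by norm_num),
        ← Real.rpow_neg (by norm_num)]
      gcongr
      · norm_num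
      · linarith
      · linarith
    simp only [Complex.ofReal_intCast] at h
    refine h.trans ?_
    have hexp : ((𝒩 z : ℤ) : ℝ) ^ (-(5 / 4) : ℝ) =
        ((𝒩 z : ℤ) : ℝ) ^ (-(7 / 4) : ℝ) * ((𝒩 z : ℤ) : ℝ) ^ (1 / 2 : ℝ) := by
      rw [← Real.rpow_add hpos]; norm_num
    calc ‖s‖ * (((𝒩 z : ℤ) : ℝ) / 4) ^ (-s.re - 1) * |((𝒩 z : ℤ) : ℝ) - 𝒩 (z - w)|
        ≤ 3 * (4 ^ (4 : ℝ) * ((𝒩 z : ℤ) : ℝ) ^ (-(7 / 4) : ℝ)) *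
          (3 * ‖emb w‖ * ((𝒩 z : ℤ) : ℝ) ^ (1 / 2 : ℝ)) := by gcongr
      _ = 3 * 4 ^ (4 : ℝ) * (3 * ‖emb w‖) * ((𝒩 z : ℤ) : ℝ) ^ (-(5 / 4) : ℝ) := by rw [hexp]; ring
      _ ≤ _ := by
          gcongr
          exact le_add_of_nonneg_left (by positivity)

/-- The Dirichlet series `∑ φ z / (𝒩 z) ^ s` over the order. -/
noncomputable def normSeries (φ : QuadOrder m → ℂ) (s : ℝ) : ℂ :=
  ∑' z, φ z * ((((𝒩 z : ℤ) : ℝ) ^ (-s) : ℝ) : ℂ)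

theorem summable_normSeries (hm : 0 < m) {φ : QuadOrder m → ℂ} (hφ : ∀ z, ‖φ z‖ ≤ 1) {s : ℝ}
    (hs : 1 < s) : Summable fun z => φ z * ((((𝒩 z : ℤ) : ℝ) ^ (-s) : ℝ) : ℂ) := by
  refine Summable.of_norm_bounded (summable_norm_rpow hm hs) fun z => ?_
  have : 0 ≤ ((𝒩 z : ℤ) : ℝ) ^ (-s) :=
    Real.rpow_nonneg (by exact_mod_cast nm_nonneg hm z) _
  rw [norm_mul, Complex.norm_real, Real.norm_of_nonneg this]
  exact mul_le_of_le_one_left this (hφ z)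

/-- Translating the coefficients changes a 𝒩 series by a function regular at `1`. -/
theorem regularAtOne_shift (hm : 0 < m) {φ : QuadOrder m → ℂ} (hφ : ∀ z, ‖φ z‖ ≤ 1)
    (w : QuadOrder m) :
    RegularAtOne fun s => normSeries φ s - normSeries (fun z => φ (z + w)) s := by
  obtain ⟨C, hC, hb⟩ := exists_shift_bound hm w
  refine ⟨fun s => ∑' z : QuadOrder m,
    φ z * (((𝒩 z : ℤ) : ℂ) ^ (-s) - ((𝒩 (z - w) : ℤ) : ℂ) ^ (-s)), ?_, ?_⟩
  · have hopen : IsOpen shiftRegion :=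
      (isOpen_lt continuous_const Complex.continuous_re).inter Metric.isOpen_ball
    have h1 : (1 : ℂ) ∈ shiftRegion := by
      refine ⟨?_, ?_⟩ <;> norm_num
    refine (DifferentiableOn.differentiableAt (s := shiftRegion) ?_ (hopen.mem_nhds h1))
    refine Complex.differentiableOn_tsum_of_summable_norm
      (u := fun z => (if z = 0 then 2 else 0) + C * ((𝒩 z : ℤ) : ℝ) ^ (-(5 / 4) : ℝ))
      ?_ ?_ hopen ?_
    · exact (summable_of_ne_finset_zero (s := {0}) (by intro b hb; simp at hb; simp [hb])).add
        ((summable_norm_rpow hm (by norm_num)).mul_left C)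
    · intro z s hs
      have hs0 : s ≠ 0 := by
        rintro rfl
        have : (3 / 4 : ℝ) < (0 : ℂ).re := hs.1
        norm_num at this
      have aux : ∀ y : QuadOrder m, DifferentiableAt ℂ (fun t : ℂ => ((𝒩 y : ℤ) : ℂ) ^ (-t)) s :=
        fun y => DifferentiableAt.const_cpow (by fun_prop) (Or.inr (by simpa using hs0))
      exact (((aux z).sub (aux (z - w))).const_mul _).differentiableWithinAt
    · intro z s hs
      rw [norm_mul]
      exact (mul_le_of_le_one_left (norm_nonneg _) (hφ z)).trans (hb z s hs)
  · filter_upwards [self_mem_nhdsWithin] with s hs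
    have hs : 1 < s := hs
    have h1 := summable_normSeries hm hφ hs
    have h2 := summable_normSeries hm (φ := fun z => φ (z + w)) (fun z => hφ _) hs
    have e2 : normSeries (fun z => φ (z + w)) s =
        ∑' z, φ z * ((((𝒩 (z - w) : ℤ) : ℝ) ^ (-s) : ℝ) : ℂ) := by
      rw [normSeries, ← (Equiv.subRight w).tsum_eq]
      simp
    have h3 : Summable fun z => φ z * ((((𝒩 (z - w) : ℤ) : ℝ) ^ (-s) : ℝ) : ℂ) := by
      have := (Equiv.subRight w).summable_iff.2 h2
      simpa [Function.comp_def] using this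
    rw [e2, normSeries, ← h1.tsum_sub h3]
    refine tsum_congr fun z => ?_
    have aux : ∀ y : QuadOrder m,
        ((((𝒩 y : ℤ) : ℝ) ^ (-s) : ℝ) : ℂ) = ((𝒩 y : ℤ) : ℂ) ^ (-(s : ℂ)) := fun y => by
      rw [Complex.ofReal_cpow (by exact_mod_cast nm_nonneg hm y)]
      push_cast; rfl
    rw [aux, aux, mul_sub]

end QuadOrder

namespace RayClass

variable {R : Type*} [CommRing R] (𝔪 : Ideal R)

/-- The monoid of ideals coprime to `𝔪`. -/
def coprimeIdeals : Submonoid (Ideal R) where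
  carrier := {a | IsCoprime a 𝔪}
  one_mem' := isCoprime_one_left
  mul_mem' := IsCoprime.mul_left

variable {𝔪}

theorem mem_coprimeIdeals {a : Ideal R} : a ∈ coprimeIdeals 𝔪 ↔ IsCoprime a 𝔪 := Iff.rfl

theorem span_mem_coprimeIdeals {t : R} (ht : t - 1 ∈ 𝔪) : Ideal.span {t} ∈ coprimeIdeals 𝔪 := by
  rw [mem_coprimeIdeals, Ideal.isCoprime_iff_exists]
  exact ⟨t, Ideal.mem_span_singleton_self t, 1 - t, by simpa using 𝔪.neg_mem ht, by ring⟩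

theorem exists_mem_of_mem_coprimeIdeals {a : Ideal R} (ha : a ∈ coprimeIdeals 𝔪) :
    ∃ t ∈ a, t - 1 ∈ 𝔪 := by
  obtain ⟨t, ht, u, hu, h⟩ := Ideal.isCoprime_iff_exists.1 ha
  exact ⟨t, ht, by rw [← h]; simpa using 𝔪.neg_mem hu⟩

theorem mul_sub_one_mem {t u : R} (ht : t - 1 ∈ 𝔪) (hu : u - 1 ∈ 𝔪) : t * u - 1 ∈ 𝔪 := by
  have := 𝔪.add_mem (𝔪.mul_mem_right u ht) hu
  convert this using 1; ring

theorem sub_one_mem_of_mul {t u : R} (ht : t - 1 ∈ 𝔪) (hu : t * u - 1 ∈ 𝔪) : u - 1 ∈ 𝔪 := by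
  have := 𝔪.sub_mem hu (𝔪.mul_mem_right u ht)
  convert this using 1; ring

variable (𝔪) in
/-- Two ideals coprime to `𝔪` are identified when they differ by principal ideals with generators
congruent to `1` modulo `𝔪`. -/
def rayCon : Con (coprimeIdeals 𝔪) where
  r a b := ∃ t u : R, t - 1 ∈ 𝔪 ∧ u - 1 ∈ 𝔪 ∧
    Ideal.span {t} * (a : Ideal R) = Ideal.span {u} * (b : Ideal R)
  iseqv :=
    ⟨fun a => ⟨1, 1, by simp, by simp, rfl⟩,
      fun ⟨t, u, ht, hu, h⟩ => ⟨u, t, hu, ht, h.symm⟩,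
      fun {a b c} ⟨t, u, ht, hu, h⟩ ⟨t', u', ht', hu', h'⟩ =>
        ⟨t' * t, u * u', mul_sub_one_mem ht' ht, mul_sub_one_mem hu hu', by
          rw [← Ideal.span_singleton_mul_span_singleton, ← Ideal.span_singleton_mul_span_singleton,
            mul_assoc, h, mul_left_comm, h', mul_assoc]⟩⟩
  mul' := fun {a b c d} ⟨t, u, ht, hu, h⟩ ⟨t', u', ht', hu', h'⟩ =>
    ⟨t * t', u * u', mul_sub_one_mem ht ht', mul_sub_one_mem hu hu', by
      rw [← Ideal.span_singleton_mul_span_singleton, ← Ideal.span_singleton_mul_span_singleton,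
        Submonoid.coe_mul, Submonoid.coe_mul, mul_mul_mul_comm, h, h', mul_mul_mul_comm]⟩

variable (𝔪) in
/-- The ray class group modulo `𝔪`. -/
abbrev RayGroup := (rayCon 𝔪).Quotient

/-- The class of an ideal. -/
def cls (a : coprimeIdeals 𝔪) : RayGroup 𝔪 := (a : (rayCon 𝔪).Quotient)

theorem cls_mul (a b : coprimeIdeals 𝔪) : cls (a * b) = cls a * cls b := rfl

theorem cls_one : cls (1 : coprimeIdeals 𝔪) = 1 := rfl

theorem cls_surjective : Function.Surjective (cls (𝔪 := 𝔪)) := Quotient.mk''_surjective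

theorem cls_eq_cls {a b : coprimeIdeals 𝔪} : cls a = cls b ↔ ∃ t u : R, t - 1 ∈ 𝔪 ∧ u - 1 ∈ 𝔪 ∧
    Ideal.span {t} * (a : Ideal R) = Ideal.span {u} * (b : Ideal R) :=
  (rayCon 𝔪).eq

theorem cls_span {t : R} (ht : t - 1 ∈ 𝔪) :
    cls ⟨Ideal.span {t}, span_mem_coprimeIdeals ht⟩ = (1 : RayGroup 𝔪) := by
  change cls _ = cls 1
  exact cls_eq_cls.2 ⟨1, t, by simp, ht, by simp⟩

theorem ne_zero_of_sub_one_mem (h𝔪 : 𝔪 ≠ ⊤) {t : R} (ht : t - 1 ∈ 𝔪) : t ≠ 0 := by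
  rintro rfl
  exact h𝔪 ((Ideal.eq_top_iff_one _).2 (by simpa using 𝔪.neg_mem ht))

variable [IsDedekindDomain R]

theorem exists_mul_eq_span {a : Ideal R} {t : R} (hta : t ∈ a)
    (ht : t - 1 ∈ 𝔪) : ∃ b : coprimeIdeals 𝔪, a * b = Ideal.span {t} := by
  obtain ⟨b, hb⟩ := Ideal.dvd_span_singleton.2 hta
  refine ⟨⟨b, ?_⟩, hb.symm⟩
  have := span_mem_coprimeIdeals ht
  rw [hb, mem_coprimeIdeals] at this
  exact this.of_mul_left_right

theorem exists_cls_mul_eq_one (x : RayGroup 𝔪) : ∃ y, x * y = 1 := by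
  obtain ⟨a, rfl⟩ := cls_surjective x
  obtain ⟨t, hta, ht⟩ := exists_mem_of_mem_coprimeIdeals a.2
  obtain ⟨b, hb⟩ := exists_mul_eq_span hta ht
  refine ⟨cls b, ?_⟩
  rw [← cls_mul, ← cls_span ht]
  congr 1
  exact Subtype.ext hb

noncomputable instance : CommGroup (RayGroup 𝔪) :=
  { (inferInstance : CommMonoid (RayGroup 𝔪)) with
    inv := fun x => (exists_cls_mul_eq_one x).choose
    inv_mul_cancel := fun x => (mul_comm _ _).trans (exists_cls_mul_eq_one x).choose_spec }

theorem cls_eq_one_iff (h𝔪 : 𝔪 ≠ ⊤) {a : coprimeIdeals 𝔪} :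
    cls a = 1 ↔ ∃ t : R, t - 1 ∈ 𝔪 ∧ (a : Ideal R) = Ideal.span {t} := by
  constructor
  · intro h
    obtain ⟨t, u, ht, hu, h⟩ := cls_eq_cls.1 (h.trans cls_one.symm)
    rw [Submonoid.coe_one, mul_one] at h
    have hu' : u ∈ Ideal.span {u} := Ideal.mem_span_singleton_self u
    rw [← h] at hu'
    obtain ⟨v, rfl⟩ := Ideal.mem_span_singleton.1 (Ideal.mul_le_left hu')
    refine ⟨v, sub_one_mem_of_mul ht hu, ?_⟩
    rw [← Ideal.span_singleton_mul_span_singleton] at h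
    exact mul_left_cancel₀ (by simpa using ne_zero_of_sub_one_mem h𝔪 ht) h
  · rintro ⟨t, ht, h⟩
    rw [← cls_span ht]
    congr 1
    exact Subtype.ext h

end RayClass

namespace QuadOrder

open QuadraticAlgebra (algebraMap_norm_eq_mul_star)
open scoped QuadraticAlgebra
open RayClass

local notation "𝒩" => QuadraticAlgebra.norm

variable {m : ℤ}

variable (m) in
/-- The different `√(1 - 4 * m)` of the order. -/
def disc : QuadOrder m := ⟨-1, 2⟩

variable (m) in
/-- The modulus used for the ray class group. -/
def modulus : Ideal (QuadOrder m) := Ideal.span {2 * disc m}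

theorem disc_mul_disc : disc m * disc m = ((-(4 * m - 1) : ℤ) : QuadOrder m) := by
  ext <;> simp [disc]; ring

theorem mem_modulus {z : QuadOrder m} :
    z ∈ modulus m ↔ 2 ∣ z.re ∧ 2 ∣ z.im ∧ 4 * m - 1 ∣ 2 * z.re + z.im := by
  rw [modulus, Ideal.mem_span_singleton]
  constructor
  · rintro ⟨w, rfl⟩
    refine ⟨⟨-w.re - 2 * m * w.im, ?_⟩, ⟨2 * w.re + w.im, ?_⟩, ⟨-2 * w.im, ?_⟩⟩ <;>
      simp [disc] <;> ring
  · rintro ⟨⟨a, ha⟩, ⟨b, hb⟩, ⟨c, hc⟩⟩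
    rw [ha, hb] at hc
    obtain ⟨d, rfl⟩ : Even c := by
      by_contra h
      have h1 : Odd ((4 * m - 1) * c) := by
        refine Odd.mul ⟨2 * m - 1, by ring⟩ (Int.not_even_iff_odd.1 h)
      rw [← hc] at h1
      exact Int.not_even_iff_odd.2 h1 ⟨2 * a + b, by ring⟩
    refine ⟨⟨-a + 2 * m * d, -d⟩, ?_⟩
    ext
    · rw [ha]; simp [disc]; ring
    · rw [hb]; simp [disc]; linarith

theorem sub_one_mem_modulus {z : QuadOrder m} :
    z - 1 ∈ modulus m ↔ Odd z.re ∧ Even z.im ∧ 4 * m - 1 ∣ 2 * z.re + z.im - 2 := by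
  rw [mem_modulus]
  have e : 2 * (z - 1).re + (z - 1).im = 2 * z.re + z.im - 2 := by simp; ring
  rw [e, even_iff_two_dvd]
  have : 2 ∣ (z - 1).re ↔ Odd z.re := by
    simp only [QuadraticAlgebra.re_sub, QuadraticAlgebra.re_one]
    rw [← even_iff_two_dvd, Int.even_sub_one, Int.not_even_iff_odd]
  rw [this]
  simp

theorem modulus_ne_top : modulus m ≠ ⊤ := by
  rw [Ne, Ideal.eq_top_iff_one, mem_modulus]
  simp

theorem modulus_ne_bot : modulus m ≠ ⊥ := by
  rw [modulus, Ne, Ideal.span_singleton_eq_bot]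
  intro h
  have := congrArg QuadraticAlgebra.im h
  simp [disc] at this

instance isDomain_of_fact [h : Fact (3 ≤ m)] : IsDomain (QuadOrder m) :=
  isDomain (by linarith [h.out])

instance isDedekindDomain_of_fact [h : Fact (3 ≤ m)] [hq : Fact (Prime (4 * m - 1))] :
    IsDedekindDomain (QuadOrder m) :=
  isDedekindDomain (by linarith [h.out]) hq.out

theorem coprime_ne_bot {a : Ideal (QuadOrder m)} (ha : a ∈ coprimeIdeals (modulus m)) : a ≠ ⊥ := by
  rintro rfl
  obtain ⟨t, ht, h1⟩ := exists_mem_of_mem_coprimeIdeals ha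
  exact ne_zero_of_sub_one_mem modulus_ne_top h1 (by simpa using ht)

section

variable [h3 : Fact (3 ≤ m)]

theorem eq_one_or_neg_one_of_nm_eq_one {z : QuadOrder m} (h : 𝒩 z = 1) : z = 1 ∨ z = -1 := by
  have hm := h3.out
  have h4 := four_mul_nm z
  have him : z.im = 0 := by
    by_contra hne
    have : 0 < z.im ^ 2 := by positivity
    nlinarith [sq_nonneg (2 * z.re + z.im)]
  rw [h, him] at h4
  have : z.re ^ 2 = 1 := by linarith
  rcases sq_eq_one_iff.1 this with h | h
  · exact Or.inl (by ext <;> simp [h, him])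
  · exact Or.inr (by ext <;> simp [h, him])

/-- Division with remainder, with a crude bound on the norm of the remainder. -/
theorem exists_nm_sub_mul_le (z : QuadOrder m) {b : QuadOrder m} (hb : b ≠ 0) :
    ∃ w, 𝒩 (z - b * w) ≤ (m + 2) * 𝒩 b := by
  have hm := h3.out
  have hN : 0 < 𝒩 b := nm_pos (by linarith) hb
  set v := z * star b with hv
  refine ⟨⟨v.re / 𝒩 b, v.im / 𝒩 b⟩, ?_⟩
  set w : QuadOrder m := ⟨v.re / 𝒩 b, v.im / 𝒩 b⟩ with hw
  have h1 : (z - b * w) * star b = ⟨v.re % 𝒩 b, v.im % 𝒩 b⟩ := by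
    have h2 : b * star b = ((𝒩 b : ℤ) : QuadOrder m) := by
      rw [← algebraMap_norm_eq_mul_star]; rfl
    rw [sub_mul, mul_right_comm, h2, ← hv]
    ext
    · simp [hw, Int.emod_def]
    · simp [hw, Int.emod_def]
  have h2 := congrArg (𝒩 : QuadOrder m → ℤ) h1
  rw [map_mul, QuadraticAlgebra.norm_star, nm_eq (⟨v.re % 𝒩 b, v.im % 𝒩 b⟩ : QuadOrder m)] at h2
  have a1 := Int.emod_nonneg v.re hN.ne'
  have a2 := Int.emod_lt_of_pos v.re hN
  have b1 := Int.emod_nonneg v.im hN.ne'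
  have b2 := Int.emod_lt_of_pos v.im hN
  set r := v.re % 𝒩 b
  set i := v.im % 𝒩 b
  have c1 : r ^ 2 ≤ 𝒩 b * 𝒩 b := by nlinarith
  have c2 : r * i ≤ 𝒩 b * 𝒩 b := by nlinarith
  have c3 : i ^ 2 ≤ 𝒩 b * 𝒩 b := by nlinarith
  have : 𝒩 (z - b * w) * 𝒩 b ≤ (m + 2) * 𝒩 b * 𝒩 b := by
    rw [h2]
    nlinarith [mul_le_mul_of_nonneg_left c3 (by linarith : 0 ≤ m)]
  exact le_of_mul_le_mul_right this hN

end

variable [h3 : Fact (3 ≤ m)] [hq : Fact (Prime (4 * m - 1))]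

theorem absNorm_span (z : QuadOrder m) : (Ideal.absNorm (Ideal.span {z}) : ℤ) = 𝒩 z :=
  absNorm_span_singleton (by linarith [h3.out]) z

theorem eq_or_eq_neg_of_span_eq {t u : QuadOrder m} (h : Ideal.span {t} = Ideal.span {u}) :
    t = u ∨ t = -u := by
  obtain ⟨v, rfl⟩ := Ideal.span_singleton_eq_span_singleton.1 h
  have h1 : 𝒩 (v : QuadOrder m) = 1 := by
    have : Ideal.span {(v : QuadOrder m)} = ⊤ := Ideal.span_singleton_eq_top.2 v.isUnit
    rw [← absNorm_span, this, Ideal.absNorm_top, Nat.cast_one]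
  rcases eq_one_or_neg_one_of_nm_eq_one h1 with h | h <;> simp [h]

theorem eq_of_span_eq {t u : QuadOrder m} (ht : t - 1 ∈ modulus m) (hu : u - 1 ∈ modulus m)
    (h : Ideal.span {t} = Ideal.span {u}) : t = u := by
  rcases eq_or_eq_neg_of_span_eq h with h | rfl
  · exact h
  · exfalso
    have h1 := (sub_one_mem_modulus.1 ht).2.2
    have h2 := (sub_one_mem_modulus.1 hu).2.2
    have h4 := dvd_add h1 h2
    have hm := h3.out
    simp only [QuadraticAlgebra.re_neg, QuadraticAlgebra.im_neg] at h4
    have := Int.le_of_dvd (by norm_num)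
      (dvd_neg.2 h4 |>.trans (by ring_nf; norm_num) : 4 * m - 1 ∣ 4)
    linarith

/-- A nonzero ideal contains a nonzero element of small norm. -/
theorem exists_nm_le {c : Ideal (QuadOrder m)} (hc : c ≠ ⊥) :
    ∃ z ∈ c, z ≠ 0 ∧ 𝒩 z ≤ (m + 2) * (Ideal.absNorm c : ℤ) := by
  have hm := h3.out
  set n := Ideal.absNorm c with hn
  have hn0 : n ≠ 0 := by rw [hn, Ne, Ideal.absNorm_eq_zero_iff]; exact hc
  have hcard : Nat.card (QuadOrder m ⧸ c) = n := rfl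
  have : Finite (QuadOrder m ⧸ c) := Nat.finite_of_card_ne_zero (by rw [hcard]; exact hn0)
  have : Fintype (QuadOrder m ⧸ c) := Fintype.ofFinite _
  set k := Nat.sqrt n with hk
  let f : Fin (k + 1) × Fin (k + 1) → QuadOrder m ⧸ c := fun p =>
    Ideal.Quotient.mk c ⟨(p.1 : ℕ), (p.2 : ℕ)⟩
  obtain ⟨x, y, hxy, hf⟩ := Fintype.exists_ne_map_eq_of_card_lt f (by
    rw [← Nat.card_eq_fintype_card, hcard, Fintype.card_prod, Fintype.card_fin]
    exact Nat.lt_succ_sqrt n)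
  refine ⟨_, Ideal.Quotient.eq.1 hf, ?_, ?_⟩
  · intro h
    apply hxy
    have h1 := congrArg QuadraticAlgebra.re h
    have h2 := congrArg QuadraticAlgebra.im h
    simp at h1 h2
    ext
    · omega
    · omega
  · rw [nm_eq]
    simp only [QuadraticAlgebra.re_sub, QuadraticAlgebra.im_sub]
    have hkk : (k : ℤ) * k ≤ n := by exact_mod_cast Nat.sqrt_le n
    set a : ℤ := (x.1 : ℕ) - (y.1 : ℕ) with ha
    set b : ℤ := (x.2 : ℕ) - (y.2 : ℕ) with hb
    have h1 : |a| ≤ k := by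
      have := x.1.2; have := y.1.2
      rw [abs_le]; omega
    have h2 : |b| ≤ k := by
      have := x.2.2; have := y.2.2
      rw [abs_le]; omega
    have h3 : a ^ 2 ≤ k * k := by rw [← sq_abs, sq]; gcongr
    have h4 : b ^ 2 ≤ k * k := by rw [← sq_abs, sq]; gcongr
    nlinarith [sq_nonneg (a - b), mul_le_mul_of_nonneg_left h4 (by linarith : 0 ≤ m)]

instance : Finite (RayGroup (modulus m)) := by
  have hm := h3.out
  set B : ℕ := ((m + 2) * ((m + 2) * (Ideal.absNorm (modulus m) : ℤ))).toNat with hB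
  have hfin : {a : Ideal (QuadOrder m) | Ideal.absNorm a ≤ B}.Finite :=
    Ideal.finite_setOfPred_absNorm_le B
  have : Finite {a : coprimeIdeals (modulus m) // Ideal.absNorm (a : Ideal (QuadOrder m)) ≤ B} :=
    (hfin.preimage (Subtype.val_injective.injOn (s := Set.univ) |>.mono
      (Set.subset_univ _))).to_subtype
  refine Finite.of_surjective (fun a : {a : coprimeIdeals (modulus m) //
    Ideal.absNorm (a : Ideal (QuadOrder m)) ≤ B} => (cls a.1)⁻¹) fun x => ?_
  obtain ⟨a, rfl⟩ := cls_surjective x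
  obtain ⟨t, hta, ht⟩ := exists_mem_of_mem_coprimeIdeals a.2
  have ha0 := coprime_ne_bot a.2
  obtain ⟨b, hb, hb0, hbn⟩ := exists_nm_le (c := modulus m * (a : Ideal (QuadOrder m))) (by
    rw [← Ideal.zero_eq_bot]; exact mul_ne_zero modulus_ne_bot ha0)
  obtain ⟨w, hw⟩ := exists_nm_sub_mul_le t hb0
  have h1 : t - b * w ∈ (a : Ideal (QuadOrder m)) :=
    Ideal.sub_mem _ hta (Ideal.mul_mem_right _ _ (Ideal.mul_le_right hb))
  have h2 : t - b * w - 1 ∈ modulus m := by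
    rw [sub_right_comm]
    exact Ideal.sub_mem _ ht (Ideal.mul_mem_right _ _ (Ideal.mul_le_left hb))
  obtain ⟨c, hc⟩ := exists_mul_eq_span h1 h2
  have hcls : cls a * cls c = 1 := by
    rw [← cls_mul, ← cls_span h2]; congr 1; exact Subtype.ext hc
  refine ⟨⟨c, ?_⟩, by simpa using (eq_inv_of_mul_eq_one_left hcls).symm⟩
  have h5 := absNorm_span (t - b * w)
  rw [← hc, map_mul] at h5
  rw [map_mul] at hbn
  push_cast at h5 hbn
  have hapos : (0 : ℤ) < Ideal.absNorm (a : Ideal (QuadOrder m)) := by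
    have : Ideal.absNorm (a : Ideal (QuadOrder m)) ≠ 0 := by
      rw [Ne, Ideal.absNorm_eq_zero_iff]; exact ha0
    positivity
  have h6 : (Ideal.absNorm (c : Ideal (QuadOrder m)) : ℤ) ≤
      (m + 2) * ((m + 2) * (Ideal.absNorm (modulus m) : ℤ)) := by
    refine le_of_mul_le_mul_left ?_ hapos
    rw [h5]
    refine hw.trans ?_
    have := mul_le_mul_of_nonneg_left hbn (by linarith : 0 ≤ m + 2)
    linarith
  omega

end QuadOrder

namespace QuadOrder

open scoped QuadraticAlgebra
open RayClass

local notation "𝒩" => QuadraticAlgebra.norm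

variable {m : ℤ}

/-- An ideal of odd norm which is stable under conjugation is principal. -/
theorem exists_eq_span_of_star_mem (hq : Prime (4 * m - 1)) {b : Ideal (QuadOrder m)}
    (hstar : ∀ z ∈ b, star z ∈ b) {n : ℤ} (hn : Odd n) (hnb : (n : QuadOrder m) ∈ b) :
    ∃ z, b = Ideal.span {z} := by
  obtain ⟨c, hc⟩ := (IsPrincipalIdealRing.principal
    (b.comap (Int.castRingHom (QuadOrder m)))).principal
  have hc : ∀ k : ℤ, (k : QuadOrder m) ∈ b ↔ c ∣ k := fun k => by
    rw [← Ideal.mem_span_singleton, ← Ideal.submodule_span_eq, ← hc]; rfl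
  let D : Ideal ℤ :=
    { carrier := {k | (k : QuadOrder m) * disc m ∈ b}
      add_mem' := fun {x y} hx hy => by
        have := b.add_mem hx hy
        rw [← add_mul] at this
        simpa using this
      zero_mem' := by simp
      smul_mem' := fun x y hy => by
        have := b.mul_mem_left (x : QuadOrder m) hy
        simpa [mul_assoc] using this }
  obtain ⟨d, hd⟩ := (IsPrincipalIdealRing.principal D).principal
  have hd : ∀ k : ℤ, (k : QuadOrder m) * disc m ∈ b ↔ d ∣ k := fun k => by
    rw [← Ideal.mem_span_singleton, ← Ideal.submodule_span_eq, ← hd]; rfl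
  have htr : ∀ z ∈ b, c ∣ 2 * z.re + z.im := fun z hz => by
    rw [← hc]
    convert b.add_mem hz (hstar z hz) using 1
    ext <;> simp; ring
  have him : ∀ z ∈ b, d ∣ z.im := fun z hz => by
    rw [← hd]
    convert b.sub_mem hz (hstar z hz) using 1
    ext <;> simp [disc]; ring
  have hcodd : Odd c := by
    obtain ⟨k, rfl⟩ := (hc n).1 hnb
    exact (Int.odd_mul.1 hn).1
  have hcb : (c : QuadOrder m) ∈ b := (hc c).2 dvd_rfl
  have hdb : (d : QuadOrder m) * disc m ∈ b := (hd d).2 dvd_rfl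
  obtain ⟨e, rfl⟩ : d ∣ c := (hd c).1 (b.mul_mem_right _ hcb)
  have hdodd : Odd d := (Int.odd_mul.1 hcodd).1
  have hd0 : d ≠ 0 := by rintro rfl; simp at hdodd
  obtain ⟨e', he'⟩ : d * e ∣ d * (4 * m - 1) := by
    rw [← hc]
    have := b.neg_mem (b.mul_mem_right (disc m) hdb)
    rw [mul_assoc, disc_mul_disc] at this
    convert this using 1
    push_cast; ring
  rw [mul_assoc] at he'
  have he' := mul_left_cancel₀ hd0 he'
  have hqodd : Odd (4 * m - 1) := ⟨2 * m - 1, by ring⟩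
  rcases hq.irreducible.isUnit_or_isUnit he' with h | h
  · refine ⟨((d * e : ℤ) : QuadOrder m), le_antisymm (fun z hz => ?_) ?_⟩
    · rw [Ideal.mem_span_singleton]
      have h1 : d * e ∣ z.im := (h.mul_right_dvd).2 (him z hz)
      have h2 : d * e ∣ 2 * z.re := by
        have := dvd_sub (htr z hz) h1
        simpa using this
      have h3 : d * e ∣ z.re := by
        refine IsCoprime.dvd_of_dvd_mul_left ?_ h2
        obtain ⟨k, hk⟩ := hcodd
        exact ⟨1, -k, by rw [hk]; ring⟩
      obtain ⟨r, hr⟩ := h3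
      obtain ⟨i, hi⟩ := h1
      refine ⟨⟨r, i⟩, ?_⟩
      ext <;> simp [hr, hi]
    · rw [Ideal.span_singleton_le_iff_mem]; exact hcb
  · refine ⟨(d : QuadOrder m) * disc m, le_antisymm (fun z hz => ?_) ?_⟩
    · rw [Ideal.mem_span_singleton]
      have h0 : d * (4 * m - 1) ∣ 2 * z.re + z.im := by
        refine dvd_trans ?_ (htr z hz)
        rw [he', ← mul_assoc]
        exact h.mul_right_dvd.2 dvd_rfl
      obtain ⟨u, hu⟩ := h0
      obtain ⟨v, hv⟩ := him z hz
      have hpar : Even (u + v) := by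
        have h5 : 2 * z.re + 2 * z.im = d * ((4 * m - 1) * u + v) := by linear_combination hu + hv
        have h6 : Even (d * ((4 * m - 1) * u + v)) := by rw [← h5]; exact ⟨z.re + z.im, by ring⟩
        rcases Int.even_mul.1 h6 with h6 | h6
        · exact absurd h6 (Int.not_even_iff_odd.2 hdodd)
        · obtain ⟨k, hk⟩ := h6
          exact ⟨k - (2 * m - 1) * u, by linear_combination hk⟩
      obtain ⟨w, hw⟩ := hpar
      refine ⟨⟨w, -u⟩, ?_⟩
      ext
      · simp [disc]
        refine mul_left_cancel₀ (two_ne_zero (α := ℤ)) ?_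
        linear_combination hu - hv - d * hw
      · simp [disc]
        linear_combination hv + d * hw
    · rw [Ideal.span_singleton_le_iff_mem]; exact hdb

theorem eq_of_sq_eq_sq {R : Type*} [CommRing R] [IsDedekindDomain R] {a b : Ideal R}
    (h : a ^ 2 = b ^ 2) : a = b :=
  dvd_antisymm ((UniqueFactorizationMonoid.pow_dvd_pow_iff_dvd two_ne_zero).1 h.dvd)
    ((UniqueFactorizationMonoid.pow_dvd_pow_iff_dvd two_ne_zero).1 h.symm.dvd)

theorem not_dvd_sq_add_one (hm : 0 < m) (hq : Prime (4 * m - 1)) (x : ℤ) :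
    ¬ 4 * m - 1 ∣ x ^ 2 + 1 := by
  intro h
  lift 4 * m - 1 to ℕ using by linarith with q hqm
  have hp : Nat.Prime q := Nat.prime_iff_prime_int.2 hq
  have : Fact q.Prime := ⟨hp⟩
  have h1 : ((x : ZMod q)) ^ 2 = -1 := by
    have := (ZMod.intCast_zmod_eq_zero_iff_dvd _ q).2 h
    push_cast at this
    exact eq_neg_of_add_eq_zero_left this
  exact ZMod.mod_four_ne_three_of_sq_eq_neg_one h1 (by omega)

variable [h3 : Fact (3 ≤ m)] [hq : Fact (Prime (4 * m - 1))]

theorem exists_eq_span_of_mul_self {a : Ideal (QuadOrder m)} {z : QuadOrder m}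
    (ha : a * a = Ideal.span {z}) (hz : z - 1 ∈ modulus m) :
    ∃ t, t - 1 ∈ modulus m ∧ a = Ideal.span {t} := by
  have hm := h3.out
  have hz0 : z ≠ 0 := ne_zero_of_sub_one_mem modulus_ne_top hz
  have ha0 : a ≠ 0 := by
    rintro rfl
    apply hz0
    rw [zero_mul] at ha
    simpa using ha.symm
  obtain ⟨hre, ⟨y, hy⟩, hdvd⟩ := sub_one_mem_modulus.1 hz
  set n : ℤ := (Ideal.absNorm a : ℤ) with hn
  have hnn : n ^ 2 = 𝒩 z := by
    rw [← absNorm_span, ← ha, map_mul, hn]; push_cast; ring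
  have h4 := four_mul_nm z
  have hnz := nm_eq z
  have hnodd : Odd n := by
    have : Odd (n ^ 2) := by
      rw [hnn, hnz, hy]
      obtain ⟨k, hk⟩ := hre
      exact ⟨2 * k ^ 2 + 2 * k + z.re * y + 2 * m * y ^ 2, by rw [hk]; ring⟩
    exact (Int.odd_pow' two_ne_zero).1 this
  set u := z.re with hu
  have hzeq : z = ⟨u, y + y⟩ := by ext <;> simp [hu, hy]
  have hnu : n ^ 2 = u ^ 2 + 2 * u * y + 4 * m * y ^ 2 := by
    rw [hnn, hnz, hy]; ring
  have hyeven : Even y := by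
    by_contra hyo
    obtain ⟨i, hi⟩ := Int.not_even_iff_odd.1 hyo
    obtain ⟨j, hj⟩ := hre
    obtain ⟨k, hk⟩ := hnodd
    rw [hi, hj, hk] at hnu
    have : 4 * (k ^ 2 + k - j ^ 2 - j - (2 * i * j + i + j) - m * (2 * i + 1) ^ 2) = 2 := by
      linear_combination hnu
    omega
  obtain ⟨s, A, hs, hA, hAodd⟩ : ∃ s A : ℤ, s ^ 2 = 1 ∧ 2 * A = n + s * (u + y) ∧ Odd A := by
    obtain ⟨i, hi⟩ := hyeven
    obtain ⟨j, hj⟩ := hre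
    obtain ⟨k, hk⟩ := hnodd
    rcases Int.even_or_odd (k + j + 1 + i) with h | h
    · refine ⟨-1, k - j - i, by norm_num, by rw [hi, hj, hk]; ring, ?_⟩
      obtain ⟨l, hl⟩ := h
      exact ⟨l - j - i - 1, by omega⟩
    · exact ⟨1, k + j + 1 + i, by norm_num, by rw [hi, hj, hk]; ring, h⟩
  have hsodd : Odd s := by
    rcases sq_eq_one_iff.1 hs with rfl | rfl <;> decide
  obtain ⟨k, hk⟩ : Even (u + s * n) := hre.add_odd (hsodd.mul hnodd)
  set c : QuadOrder m := ⟨k, y⟩ with hc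
  have hc1 : star c * z = ((s * n : ℤ) : QuadOrder m) * c := by
    rw [hzeq]
    ext
    · simp [hc]
      refine mul_left_cancel₀ (two_ne_zero (α := ℤ)) ?_
      linear_combination -hnu + (s * n - u) * hk - n ^ 2 * hs
    · simp [hc]
      linear_combination (-y) * hk
  have hc2 : 𝒩 c = n * A := by
    rw [nm_eq]
    refine mul_left_cancel₀ (four_ne_zero (α := ℤ)) ?_
    simp only [hc]
    linear_combination -hnu + n ^ 2 * hs - (2 * k + u + s * n + 2 * y) * hk - 2 * n * hA
  let φ := starRingEnd (QuadOrder m)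
  have hφ : ∀ x, φ x = star x := fun x => rfl
  have haφ : a * a.map φ = Ideal.span {(n : QuadOrder m)} := by
    apply eq_of_sq_eq_sq
    rw [mul_pow, sq, sq (a.map φ), ha, ← Ideal.map_mul, ha, Ideal.map_span, Set.image_singleton,
      hφ, Ideal.span_singleton_mul_span_singleton, Ideal.span_singleton_pow,
      ← QuadraticAlgebra.algebraMap_norm_eq_mul_star, ← hnn]
    simp
  set b := a * Ideal.span {star c} with hb
  have hbφ : b.map φ = b := by
    apply mul_left_cancel₀ ha0
    rw [hb, Ideal.map_mul, ← mul_assoc, haφ, ← mul_assoc, ha, Ideal.map_span, Set.image_singleton,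
      hφ, star_star, Ideal.span_singleton_mul_span_singleton,
      Ideal.span_singleton_mul_span_singleton, mul_comm z, hc1]
    rcases sq_eq_one_iff.1 hs with rfl | rfl
    · simp
    · rw [← Ideal.span_singleton_neg]
      simp
  obtain ⟨w, hw⟩ := exists_eq_span_of_star_mem hq.out (b := b) (n := n * (n * A))
    (fun x hx => by
      have := Ideal.mem_map_of_mem φ hx
      rwa [hbφ] at this) (hnodd.mul (hnodd.mul hAodd)) (by
      rw [← hc2, Int.cast_mul]
      refine Ideal.mul_mem_mul ?_ ?_
      · rw [hn, Int.cast_natCast]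
        exact Ideal.absNorm_mem a
      · rw [Ideal.mem_span_singleton]
        refine ⟨c, ?_⟩
        rw [mul_comm, ← QuadraticAlgebra.algebraMap_norm_eq_mul_star]
        rfl)
  have hc0 : star c ≠ 0 := by
    intro h
    have : 𝒩 (star c) = 0 := by rw [h]; simp
    rw [QuadraticAlgebra.norm_star, hc2] at this
    have h1 := hnodd.mul hAodd
    rw [this] at h1
    simp at h1
  have hwb : w ∈ b := by rw [hw]; exact Ideal.mem_span_singleton_self w
  obtain ⟨e, rfl⟩ := Ideal.mem_span_singleton.1 (Ideal.mul_le_right hwb)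
  have hae : a = Ideal.span {e} := by
    rw [hb, ← Ideal.span_singleton_mul_span_singleton, mul_comm] at hw
    exact mul_left_cancel₀ (by simpa using hc0) hw
  have hez : e * e = z ∨ e * e = -z := by
    apply eq_or_eq_neg_of_span_eq
    rw [← Ideal.span_singleton_mul_span_singleton, ← hae, ha]
  have hen : 𝒩 e = n := by rw [← absNorm_span, ← hae]
  have heim : Even e.im := by
    by_contra h
    have h1 : Even (e.im * (2 * e.re + e.im)) := by
      have h2 : (e * e).im = e.im * (2 * e.re + e.im) := by simp; ring
      rw [← h2]
      rcases hez with h | h <;> rw [h] <;> simp [hy]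
    rw [Int.not_even_iff_odd] at h
    have h3 : Odd (e.im * (2 * e.re + e.im)) := h.mul ((even_two_mul _).add_odd h)
    exact Int.not_even_iff_odd.2 h3 h1
  obtain ⟨v, hv⟩ := heim
  have here : Odd e.re := by
    by_contra h
    rw [Int.not_odd_iff_even] at h
    obtain ⟨r, hr⟩ := h
    rw [nm_eq, hv, hr] at hen
    apply Int.not_even_iff_odd.2 hnodd
    exact ⟨2 * r ^ 2 + 2 * r * v + 2 * m * v ^ 2, by rw [← hen]; ring⟩
  have hsq : (4 * m - 1) ∣ (e.re + v) ^ 2 - 1 := by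
    have h1 : (e * e).re = e.re ^ 2 - 4 * m * v ^ 2 := by simp [hv]; ring
    have h2 : (e * e).im = 2 * (2 * v * (e.re + v)) := by simp [hv]; ring
    have hq2 : (4 * m - 1) ∣ u + y - 1 := by
      rw [hy] at hdvd
      refine IsCoprime.dvd_of_dvd_mul_left (x := 4 * m - 1) (y := 2) ⟨-1, 2 * m, by ring⟩ ?_
      exact hdvd.trans (dvd_of_eq (by ring))
    rcases hez with h | h
    · rw [h] at h1 h2
      obtain ⟨l, hl⟩ := hq2
      refine ⟨l + v ^ 2, ?_⟩
      have h2 : y = 2 * v * (e.re + v) := by omega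
      linear_combination -h1 - h2 + hl
    · exfalso
      rw [h] at h1 h2
      simp only [QuadraticAlgebra.re_neg, QuadraticAlgebra.im_neg] at h1 h2
      obtain ⟨l, hl⟩ := hq2
      refine not_dvd_sq_add_one (by linarith) hq.out (e.re + v) ⟨v ^ 2 - l, ?_⟩
      have h2 : -y = 2 * v * (e.re + v) := by omega
      linear_combination -h1 - h2 - hl
  have hfac : (e.re + v) ^ 2 - 1 = (e.re + v - 1) * (e.re + v + 1) := by ring
  rw [hfac] at hsq
  rcases hq.out.dvd_or_dvd hsq with h | h
  · refine ⟨e, sub_one_mem_modulus.2 ⟨here, ⟨v, hv⟩, ?_⟩, hae⟩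
    rw [hv]
    exact (h.mul_left 2).trans (dvd_of_eq (by ring))
  · refine ⟨-e, sub_one_mem_modulus.2 ⟨by simpa using here, ⟨-v, by simp [hv]⟩, ?_⟩, by
      rw [hae, Ideal.span_singleton_neg]⟩
    simp only [QuadraticAlgebra.re_neg, QuadraticAlgebra.im_neg]
    rw [hv]
    exact (h.mul_left (-2)).trans (dvd_of_eq (by ring))

theorem eq_one_of_mul_self {x : RayGroup (modulus m)} (h : x * x = 1) : x = 1 := by
  obtain ⟨a, rfl⟩ := cls_surjective x
  rw [← cls_mul, cls_eq_one_iff modulus_ne_top] at h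
  obtain ⟨z, hz, h⟩ := h
  obtain ⟨t, ht, h⟩ := exists_eq_span_of_mul_self h hz
  exact (cls_eq_one_iff modulus_ne_top).2 ⟨t, ht, h⟩

end QuadOrder

namespace QuadOrder

open scoped QuadraticAlgebra
open RayClass

variable {m : ℤ}

theorem span_intCast_mem_coprimeIdeals {c : ℤ} (hc : IsCoprime c (2 * (4 * m - 1))) :
    Ideal.span {(c : QuadOrder m)} ∈ coprimeIdeals (modulus m) := by
  obtain ⟨u, v, h⟩ := hc
  rw [mem_coprimeIdeals, Ideal.isCoprime_iff_exists]
  refine ⟨(u : QuadOrder m) * c, Ideal.mul_mem_left _ _ (Ideal.mem_span_singleton_self _),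
    ((v * (2 * (4 * m - 1)) : ℤ) : QuadOrder m), ?_, ?_⟩
  · rw [modulus, Ideal.mem_span_singleton]
    refine ⟨((-v : ℤ) : QuadOrder m) * disc m, ?_⟩
    rw [mul_mul_mul_comm, disc_mul_disc]
    push_cast; ring
  · rw [← Int.cast_mul, ← Int.cast_add, h, Int.cast_one]

theorem not_dvd_three [h3 : Fact (3 ≤ m)] : ¬ 4 * m - 1 ∣ (3 : ℤ) ^ 2 - 1 := by
  have hm := h3.out
  intro h
  have := Int.le_of_dvd (by norm_num) h
  norm_num at this
  linarith

variable [h3 : Fact (3 ≤ m)] [hq : Fact (Prime (4 * m - 1))]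

theorem exists_eq_sq_add_mul_sq {c : ℤ} (hc : IsCoprime c (2 * (4 * m - 1)))
    {a : coprimeIdeals (modulus m)}
    (h : cls a * cls ⟨_, span_intCast_mem_coprimeIdeals hc⟩ = 1) :
    ∃ x y : ℤ, (Ideal.absNorm (a : Ideal (QuadOrder m)) : ℤ) = x ^ 2 + (4 * m - 1) * y ^ 2 ∧
      4 * m - 1 ∣ c * x - 1 := by
  rw [← cls_mul, cls_eq_one_iff modulus_ne_top] at h
  obtain ⟨z, hz, h⟩ := h
  simp only [Submonoid.coe_mul] at h
  have hza : z ∈ (a : Ideal (QuadOrder m)) * Ideal.span {(c : QuadOrder m)} := by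
    rw [h]; exact Ideal.mem_span_singleton_self z
  obtain ⟨w, rfl⟩ := Ideal.mem_span_singleton.1 (Ideal.mul_le_right hza)
  have hc0 : (c : QuadOrder m) ≠ 0 := by
    intro h0
    exact ne_zero_of_sub_one_mem modulus_ne_top hz (by rw [h0, zero_mul])
  have haw : (a : Ideal (QuadOrder m)) = Ideal.span {w} := by
    rw [← Ideal.span_singleton_mul_span_singleton, mul_comm] at h
    exact mul_left_cancel₀ (by simpa using hc0) h
  obtain ⟨h1, h2, h4⟩ := sub_one_mem_modulus.1 hz
  have hcodd : Odd c := by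
    by_contra hce
    rw [Int.not_odd_iff_even] at hce
    obtain ⟨k, hk⟩ := hce
    obtain ⟨u, v, huv⟩ := hc
    rw [hk] at huv
    have : 2 * (u * k + v * (4 * m - 1)) = 1 := by linear_combination huv
    omega
  simp only [QuadraticAlgebra.re_mul, QuadraticAlgebra.im_mul, QuadraticAlgebra.re_intCast,
    QuadraticAlgebra.im_intCast, zero_mul, mul_zero, add_zero, Int.cast_id] at h1 h2 h4
  obtain ⟨y, hy⟩ : Even w.im := by
    rcases Int.even_mul.1 h2 with h | h
    · exact absurd h (Int.not_even_iff_odd.2 hcodd)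
    · exact h
  refine ⟨w.re + y, y, ?_, ?_⟩
  · rw [haw, absNorm_span, nm_eq, hy]; ring
  · refine IsCoprime.dvd_of_dvd_mul_left (x := 4 * m - 1) (y := 2) ⟨-1, 2 * m, by ring⟩ ?_
    rw [hy] at h4
    exact h4.trans (dvd_of_eq (by ring))

/-- The conclusion of the main theorem, for a prime ideal of degree one whose class is that of an
integer not congruent to `± 1`. -/
theorem exists_of_cls_mul_eq_one {c : ℤ} (hc : IsCoprime c (2 * (4 * m - 1)))
    (hc1 : ¬ 4 * m - 1 ∣ c ^ 2 - 1) {a : coprimeIdeals (modulus m)}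
    (h : cls a * cls ⟨_, span_intCast_mem_coprimeIdeals hc⟩ = 1) :
    (∃ x y : ℤ, (Ideal.absNorm (a : Ideal (QuadOrder m)) : ℤ) = x ^ 2 + (4 * m - 1) * y ^ 2) ∧
      ¬ 4 * m - 1 ∣ (Ideal.absNorm (a : Ideal (QuadOrder m)) : ℤ) ∧
      ¬ 4 * m - 1 ∣ (Ideal.absNorm (a : Ideal (QuadOrder m)) : ℤ) - 1 := by
  obtain ⟨x, y, hxy, hx⟩ := exists_eq_sq_add_mul_sq hc h
  refine ⟨⟨x, y, hxy⟩, fun hd => ?_, fun hd => hc1 ?_⟩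
  · rw [hxy] at hd
    have h1 : 4 * m - 1 ∣ x ^ 2 := (dvd_add_left (dvd_mul_right _ _)).1 hd
    have h2 := hq.out.dvd_of_dvd_pow h1
    have h4 := dvd_sub (h2.mul_left c) hx
    rw [sub_sub_cancel] at h4
    exact hq.out.not_isUnit (isUnit_of_dvd_one h4)
  · rw [hxy] at hd
    have h1 : 4 * m - 1 ∣ x ^ 2 - 1 := by
      have := dvd_sub hd (dvd_mul_right (4 * m - 1) (y ^ 2))
      exact this.trans (dvd_of_eq (by ring))
    have h2 : c ^ 2 - 1 = (c * x - 1) * (c * x + 1) - c ^ 2 * (x ^ 2 - 1) := by ring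
    rw [h2]
    exact dvd_sub (hx.mul_right _) (h1.mul_left _)

theorem isCoprime_three : IsCoprime (3 : ℤ) (2 * (4 * m - 1)) := by
  have hm := h3.out
  have h : ¬ (3 : ℤ) ∣ 4 * m - 1 := by
    intro h
    have h1 := (Int.prime_three.dvd_prime_iff_associated hq.out).1 h
    rw [Int.associated_iff_natAbs] at h1
    omega
  exact IsCoprime.mul_right ⟨1, -1, by norm_num⟩ ((Int.prime_three.coprime_iff_not_dvd).2 h)

/-- If every ray class or its inverse contains a prime ideal of degree one, the main conclusion
holds. -/
theorem exists_prime_of_forall_cls (H : ∀ k : RayGroup (modulus m),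
    ∃ a : coprimeIdeals (modulus m), (Ideal.absNorm (a : Ideal (QuadOrder m))).Prime ∧
      (cls a = k ∨ cls a = k⁻¹)) :
    ∃ p : ℕ, p.Prime ∧ (∃ x y : ℤ, (p : ℤ) = x ^ 2 + (4 * m - 1) * y ^ 2) ∧
      ¬ 4 * m - 1 ∣ (p : ℤ) ∧ ¬ 4 * m - 1 ∣ (p : ℤ) - 1 := by
  obtain ⟨u, v, huv⟩ := isCoprime_three (m := m)
  have hu : IsCoprime u (2 * (4 * m - 1)) := ⟨3, v, by linear_combination huv⟩
  have hu1 : ¬ 4 * m - 1 ∣ u ^ 2 - 1 := fun h => not_dvd_three (m := m) (by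
    have h1 : (3 : ℤ) ^ 2 - 1 = - (9 * (u ^ 2 - 1) + (4 * m - 1) * (2 * v * (u * 3 + 1))) := by
      linear_combination (u * 3 + 1) * huv
    rw [h1, dvd_neg]
    exact dvd_add (h.mul_left _) (dvd_mul_right _ _))
  have hmul : cls ⟨_, span_intCast_mem_coprimeIdeals isCoprime_three⟩ *
      cls ⟨_, span_intCast_mem_coprimeIdeals hu⟩ = (1 : RayGroup (modulus m)) := by
    rw [← cls_mul]
    have ht : ((3 * u : ℤ) : QuadOrder m) - 1 ∈ modulus m := by
      rw [show ((3 * u : ℤ) : QuadOrder m) - 1 = ((3 * u - 1 : ℤ) : QuadOrder m) by push_cast; ring,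
        mem_modulus]
      have : 3 * u - 1 = 2 * ((4 * m - 1) * (-v)) := by linear_combination huv
      rw [this]
      simp only [QuadraticAlgebra.re_intCast, QuadraticAlgebra.im_intCast, Int.cast_id]
      exact ⟨dvd_mul_right _ _, dvd_zero _, ⟨4 * -v, by ring⟩⟩
    rw [← cls_span ht]
    congr 1
    ext1
    simp [Ideal.span_singleton_mul_span_singleton]
  obtain ⟨a, hp, h⟩ := H (cls ⟨_, span_intCast_mem_coprimeIdeals isCoprime_three⟩)
  refine ⟨_, hp, ?_⟩
  rcases h with h | h
  · exact exists_of_cls_mul_eq_one hu hu1 (by rw [h, hmul])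
  · exact exists_of_cls_mul_eq_one isCoprime_three not_dvd_three (by rw [h, inv_mul_cancel])

end QuadOrder

namespace IdealEulerProduct

open UniqueFactorizationMonoid

variable {R : Type*} [CommRing R]

section Label

variable [Countable (Ideal R)]

/-- A rational prime attached injectively to every ideal. -/
noncomputable def label (𝔭 : Ideal R) : ℕ :=
  Nat.nth Nat.Prime ((Encodable.ofCountable (Ideal R)).encode 𝔭)

theorem label_prime (𝔭 : Ideal R) : (label 𝔭).Prime := Nat.prime_nth_prime _

theorem label_injective : Function.Injective (label (R := R)) := by
  let e := Encodable.ofCountable (Ideal R)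
  exact (Nat.nth_injective Nat.infinite_setOfPred_prime).comp e.encode_injective

end Label

variable [IsDedekindDomain R] [Countable (Ideal R)]

open Classical in
/-- The multiplicative map from ideals to natural numbers determined by `label`. -/
noncomputable def toNat (a : Ideal R) : ℕ :=
  if a = 0 then 0 else ((normalizedFactors a).map label).prod

theorem toNat_mul (a b : Ideal R) : toNat (a * b) = toNat a * toNat b := by
  classical
  by_cases ha : a = 0
  · simp [toNat, ha]
  by_cases hb : b = 0
  · simp [toNat, hb]
  rw [toNat, toNat, toNat, if_neg ha, if_neg hb, if_neg (mul_ne_zero ha hb),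
    normalizedFactors_mul ha hb, Multiset.map_add, Multiset.prod_add]

theorem toNat_one : toNat (1 : Ideal R) = 1 := by
  rw [toNat, if_neg one_ne_zero, normalizedFactors_one]
  simp

theorem toNat_zero : toNat (0 : Ideal R) = 0 := by
  simp [toNat]

theorem toNat_prime {𝔭 : Ideal R} (h : Prime 𝔭) : toNat 𝔭 = label 𝔭 := by
  rw [toNat, if_neg h.ne_zero, normalizedFactors_irreducible h.irreducible]
  simp

open Classical in
/-- The prime ideal with a given label, or `0`. -/
noncomputable def ofLabel (R : Type*) [CommRing R] [IsDedekindDomain R]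
    [Countable (Ideal R)] (p : ℕ) : Ideal R :=
  if h : ∃ 𝔭 : Ideal R, Prime 𝔭 ∧ label 𝔭 = p then h.choose else 0

theorem ofLabel_label {𝔭 : Ideal R} (h : Prime 𝔭) : ofLabel R (label 𝔭) = 𝔭 := by
  have h1 : ∃ 𝔮 : Ideal R, Prime 𝔮 ∧ label 𝔮 = label 𝔭 := ⟨𝔭, h, rfl⟩
  rw [ofLabel, dif_pos h1]
  exact label_injective h1.choose_spec.2

theorem exists_of_ofLabel_ne_zero {p : ℕ} (h : ofLabel R p ≠ 0) :
    ∃ 𝔭 : Ideal R, Prime 𝔭 ∧ label 𝔭 = p := by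
  by_contra h1
  exact h (by rw [ofLabel, dif_neg h1])

variable (R) in
/-- The partial inverse of `toNat`. -/
noncomputable def ofNat : ℕ →*₀ Ideal R where
  toFun n := if n = 0 then 0 else (n.primeFactorsList.map (ofLabel R)).prod
  map_zero' := by simp
  map_one' := by simp
  map_mul' a b := by
    by_cases ha : a = 0
    · simp [ha]
    by_cases hb : b = 0
    · simp [hb]
    have := ((Nat.perm_primeFactorsList_mul ha hb).map (ofLabel R)).prod_eq
    simp [ha, hb, this]

theorem ofNat_prime {p : ℕ} (hp : p.Prime) : ofNat R p = ofLabel R p := by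
  change (if p = 0 then 0 else _) = _
  rw [if_neg hp.ne_zero, Nat.primeFactorsList_prime hp]
  simp

theorem ofNat_toNat (a : Ideal R) : ofNat R (toNat a) = a := by
  induction a using induction_on_prime with
  | h₁ => rw [toNat_zero, map_zero]
  | h₂ x hx =>
    rw [Ideal.isUnit_iff] at hx
    rw [hx, ← Ideal.one_eq_top, toNat_one, map_one]
  | h₃ a p _ hp ih =>
    rw [toNat_mul, map_mul, ih, toNat_prime hp, ofNat_prime (label_prime p), ofLabel_label hp]

theorem toNat_ofNat {n : ℕ} (h : ofNat R n ≠ 0) : toNat (ofNat R n) = n := by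
  induction n using induction_on_primes with
  | zero => rw [map_zero, toNat_zero]
  | one => rw [map_one, toNat_one]
  | prime_mul p a hp ih =>
    rw [map_mul] at h ⊢
    rw [toNat_mul, ih (right_ne_zero_of_mul h), ofNat_prime hp]
    have h1 := left_ne_zero_of_mul h
    rw [ofNat_prime hp] at h1
    obtain ⟨𝔭, h𝔭, rfl⟩ := exists_of_ofLabel_ne_zero h1
    rw [ofLabel_label h𝔭, toNat_prime h𝔭]

theorem toNat_injective : Function.Injective (toNat (R := R)) :=
  Function.LeftInverse.injective ofNat_toNat

variable {f : Ideal R →*₀ ℂ}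

/-- The Euler product over the prime ideals of a Dedekind domain. -/
theorem exp_tsum_log_eq_tsum (hf : Summable fun a => ‖f a‖) :
    Complex.exp (∑' 𝔭 : {𝔭 : Ideal R // Prime 𝔭}, -Complex.log (1 - f 𝔭)) = ∑' a, f a := by
  let F : ℕ →*₀ ℂ := f.comp (ofNat R)
  have hF : ∀ n, F n = f (ofNat R n) := fun _ => rfl
  have hsupp : Function.support F ⊆ Set.range (toNat (R := R)) := by
    intro n hn
    rw [Function.mem_support, hF] at hn
    exact ⟨_, toNat_ofNat fun h => hn (by rw [h, map_zero])⟩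
  have hsum : Summable (‖F ·‖) := by
    rw [← (toNat_injective (R := R)).summable_iff]
    · simpa [Function.comp_def, hF, ofNat_toNat] using hf
    · intro n hn
      by_contra h
      exact hn (hsupp fun h' => h (by rw [h', norm_zero]))
  have h := EulerProduct.exp_tsum_primes_log_eq_tsum hsum
  rw [← toNat_injective.tsum_eq hsupp] at h
  simp only [hF, ofNat_toNat] at h
  rw [← h]
  congr 1
  let j : {𝔭 : Ideal R // Prime 𝔭} → Nat.Primes := fun 𝔭 => ⟨label 𝔭.1, label_prime _⟩
  have hj : Function.Injective j := fun a b hab =>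
    Subtype.ext (label_injective (congrArg Subtype.val hab))
  rw [← hj.tsum_eq]
  · exact tsum_congr fun 𝔭 => by
      rw [ofNat_prime (label_prime _), ofLabel_label 𝔭.2]
  · intro p hp
    rw [Function.mem_support, ofNat_prime p.2] at hp
    obtain ⟨𝔭, h𝔭, h1⟩ := exists_of_ofLabel_ne_zero (R := R) (p := p)
      fun h' => hp (by rw [h', map_zero]; simp)
    exact ⟨⟨𝔭, h𝔭⟩, Subtype.ext h1⟩

theorem norm_neg_log_sub_le {z : ℂ} (hz : ‖z‖ ≤ 1 / 2) :
    ‖-Complex.log (1 - z) - z‖ ≤ ‖z‖ ^ 2 := by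
  have h1 : ‖z‖ < 1 := by linarith
  have h := Complex.norm_log_one_sub_inv_sub_self_le h1
  rw [Complex.log_inv _ (Complex.slitPlane_arg_ne_pi (by
    have := Complex.mem_slitPlane_of_norm_lt_one (z := -z) (by rwa [norm_neg])
    rwa [← sub_eq_add_neg] at this))] at h
  refine h.trans ?_
  have h2 : (1 - ‖z‖)⁻¹ ≤ 2 := by
    rw [inv_le_comm₀ (by linarith) (by norm_num)]; linarith
  nlinarith [sq_nonneg ‖z‖]

theorem abs_re_tsum_sub_log_le (hf : Summable fun a => ‖f a‖)
    (hf2 : ∀ 𝔭 : {𝔭 : Ideal R // Prime 𝔭}, ‖f 𝔭‖ ≤ 1 / 2) :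
    |(∑' 𝔭 : {𝔭 : Ideal R // Prime 𝔭}, f 𝔭).re - Real.log ‖∑' a, f a‖| ≤
      ∑' 𝔭 : {𝔭 : Ideal R // Prime 𝔭}, ‖f 𝔭‖ ^ 2 := by
  have hs : Summable fun 𝔭 : {𝔭 : Ideal R // Prime 𝔭} => ‖f 𝔭‖ := hf.subtype _
  have hs2 : Summable fun 𝔭 : {𝔭 : Ideal R // Prime 𝔭} => ‖f 𝔭‖ ^ 2 :=
    Summable.of_nonneg_of_le (fun _ => by positivity)
      (fun 𝔭 => by nlinarith [norm_nonneg (f 𝔭), hf2 𝔭]) hs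
  have hlog := hs.of_norm.clog_one_sub.neg
  rw [← exp_tsum_log_eq_tsum hf, Complex.norm_exp, Real.log_exp, abs_sub_comm,
    ← Complex.sub_re, ← hlog.tsum_sub hs.of_norm]
  refine (Complex.abs_re_le_norm _).trans (tsum_of_norm_bounded hs2.hasSum fun 𝔭 => ?_)
  exact norm_neg_log_sub_le (hf2 𝔭)

end IdealEulerProduct

namespace RegularAtOne

variable {f : ℝ → ℂ}

theorem const_mul (c : ℂ) (hf : RegularAtOne f) : RegularAtOne fun s => c * f s :=
  (const c).mul hf

theorem tendsto_ofReal : Tendsto (fun s : ℝ => (s : ℂ)) (𝓝[>] 1) (𝓝 1) := by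
  have : Tendsto (fun s : ℝ => (s : ℂ)) (𝓝 1) (𝓝 ((1 : ℝ) : ℂ)) :=
    Complex.continuous_ofReal.tendsto 1
  rw [Complex.ofReal_one] at this
  exact this.mono_left nhdsWithin_le_nhds

theorem eventually_le (hf : RegularAtOne f) : ∃ C : ℝ, ∀ᶠ s : ℝ in 𝓝[>] 1, ‖f s‖ ≤ C := by
  obtain ⟨F, hF, hfF⟩ := hf
  have h := (hF.continuousAt.tendsto.comp tendsto_ofReal).norm.eventually_le_const
    (lt_add_one ‖F 1‖)
  exact ⟨‖F 1‖ + 1, by filter_upwards [h, hfF] with s h1 h2; rw [h2]; exact h1⟩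

/-- A regular function is either bounded away from zero or vanishes at `1`. -/
theorem eventually_ge_or_le (hf : RegularAtOne f) :
    (∃ c > 0, ∀ᶠ s : ℝ in 𝓝[>] 1, c ≤ ‖f s‖) ∨
      ∃ C > 0, ∀ᶠ s : ℝ in 𝓝[>] 1, ‖f s‖ ≤ C * (s - 1) := by
  obtain ⟨F, hF, hfF⟩ := hf
  by_cases h0 : F 1 = 0
  · right
    obtain ⟨C, hC, h⟩ := hF.isBigO_sub.exists_pos
    refine ⟨C, hC, ?_⟩
    filter_upwards [tendsto_ofReal.eventually h.bound, hfF, self_mem_nhdsWithin] with s h1 h2 hs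
    have hs : 1 < s := hs
    rw [h0, sub_zero, ← h2, ← Complex.ofReal_one, ← Complex.ofReal_sub, Complex.norm_real,
      Real.norm_of_nonneg (by linarith)] at h1
    exact h1
  · left
    have hpos : 0 < ‖F 1‖ := norm_pos_iff.2 h0
    have h := (hF.continuousAt.tendsto.comp tendsto_ofReal).norm.eventually_const_le
      (half_lt_self hpos)
    exact ⟨‖F 1‖ / 2, by positivity, by filter_upwards [h, hfF] with s h1 h2; rw [h2]; exact h1⟩

theorem differentiable_dslope {n : ℝ} (hn : 0 < n) :
    Differentiable ℂ (dslope (fun s : ℂ => (n : ℂ) ^ (s - 1)) 1) := by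
  have hn' : (n : ℂ) ≠ 0 := by exact_mod_cast hn.ne'
  rw [← differentiableOn_univ]
  refine (Complex.differentiableOn_dslope univ_mem).2 fun s _ => ?_
  exact (DifferentiableAt.const_cpow (by fun_prop) (Or.inl hn')).differentiableWithinAt

theorem dslope_one {n : ℝ} (hn : 0 < n) :
    dslope (fun s : ℂ => (n : ℂ) ^ (s - 1)) 1 1 = Complex.log n := by
  have hn' : (n : ℂ) ≠ 0 := by exact_mod_cast hn.ne'
  rw [dslope_same]
  have h := ((hasDerivAt_id (1 : ℂ)).sub_const 1).const_cpow (c := (n : ℂ)) (Or.inl hn')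
  simpa using h.deriv

theorem dslope_ofReal {n s : ℝ} (hn : 0 < n) (hs : 1 < s) :
    dslope (fun s : ℂ => (n : ℂ) ^ (s - 1)) 1 s = ((n ^ (s - 1) : ℝ) - 1 : ℂ) / (s - 1) := by
  rw [dslope_of_ne _ (by exact_mod_cast hs.ne'), slope_def_field, Complex.ofReal_cpow hn.le]
  simp

theorem rpow_sub_one_div {n : ℝ} (hn : 0 < n) :
    RegularAtOne fun s => ((n ^ (s - 1) : ℝ) - 1 : ℂ) / (s - 1) := by
  refine ⟨_, differentiable_dslope hn 1, ?_⟩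
  filter_upwards [self_mem_nhdsWithin] with s hs
  rw [dslope_ofReal hn hs]

theorem div_rpow_sub_one {n : ℝ} (hn : 0 < n) (hn1 : n ≠ 1) :
    RegularAtOne fun s => (s - 1) / ((n ^ (s - 1) : ℝ) - 1 : ℂ) := by
  refine ⟨fun s => (dslope (fun s : ℂ => (n : ℂ) ^ (s - 1)) 1 s)⁻¹,
    (differentiable_dslope hn 1).fun_inv ?_, ?_⟩
  · rw [dslope_one hn, ← Complex.ofReal_log hn.le]
    exact_mod_cast Real.log_ne_zero_of_pos_of_ne_one hn hn1
  · filter_upwards [self_mem_nhdsWithin] with s hs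
    rw [dslope_ofReal hn hs, inv_div]

end RegularAtOne

theorem tsum_ite_eq_tsum_subtype {α : Type*} (p : α → Prop) [DecidablePred p] (f : α → ℂ) :
    ∑' a, (if p a then f a else 0) = ∑' a : {a // p a}, f a := by
  refine Eq.trans (tsum_congr fun a => ?_) (tsum_subtype {a | p a} f).symm
  simp [Set.indicator_apply]

theorem summable_ite_of_summable_subtype {α : Type*} (p : α → Prop) [DecidablePred p] (f : α → ℝ)
    (h : Summable fun a : {a // p a} => f a) : Summable fun a => if p a then f a else 0 := by
  refine Summable.congr (summable_subtype_iff_indicator (s := {a | p a}).1 h) fun a => ?_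
  simp [Set.indicator_apply]

namespace QuadOrder

open scoped QuadraticAlgebra
open RayClass

local notation "𝒩" => QuadraticAlgebra.norm

variable {m : ℤ}

/-- The elements of an ideal that are congruent to `1` modulo `modulus m`. -/
def unitSet (b : Ideal (QuadOrder m)) : Set (QuadOrder m) := {z | z - 1 ∈ modulus m ∧ z ∈ b}

/-- The sum of `1 / (𝒩 z) ^ s` over `unitSet b`. -/
noncomputable def unitSeries (b : Ideal (QuadOrder m)) (s : ℝ) : ℂ :=
  normSeries ((unitSet b).indicator 1) s

theorem norm_indicator_le (A : Set (QuadOrder m)) (z : QuadOrder m) :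
    ‖A.indicator (1 : QuadOrder m → ℂ) z‖ ≤ 1 := by
  by_cases h : z ∈ A <;> simp [h]

theorem unitSeries_eq (b : Ideal (QuadOrder m)) (s : ℝ) :
    unitSeries b s = ∑' z : unitSet b, ((((𝒩 (z : QuadOrder m) : ℤ) : ℝ) ^ (-s) : ℝ) : ℂ) := by
  rw [unitSeries, normSeries,
    tsum_subtype (unitSet b) fun z => ((((𝒩 z : ℤ) : ℝ) ^ (-s) : ℝ) : ℂ)]
  refine tsum_congr fun z => ?_
  by_cases h : z ∈ unitSet b <;> simp [h]

variable [h3 : Fact (3 ≤ m)] [hq : Fact (Prime (4 * m - 1))]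

theorem absNorm_span_eq (z : QuadOrder m) :
    (Ideal.absNorm (Ideal.span {z}) : ℝ) = ((𝒩 z : ℤ) : ℝ) := by
  exact_mod_cast absNorm_span z

open Classical in
/-- The partial zeta function of a ray class. -/
noncomputable def classSum (k : RayGroup (modulus m)) (s : ℝ) : ℂ :=
  ∑' a : coprimeIdeals (modulus m),
    if cls a = k then ((((Ideal.absNorm (a : Ideal (QuadOrder m)) : ℝ) ^ (-s) : ℝ)) : ℂ) else 0

theorem exists_unitSet_of_cls_mul {a b : coprimeIdeals (modulus m)} (h : cls a * cls b = 1) :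
    ∃ z : unitSet (b : Ideal (QuadOrder m)),
      (a : Ideal (QuadOrder m)) * b = Ideal.span {(z : QuadOrder m)} := by
  rw [← cls_mul, cls_eq_one_iff modulus_ne_top] at h
  obtain ⟨t, ht, h⟩ := h
  refine ⟨⟨t, ht, ?_⟩, h⟩
  rw [Submonoid.coe_mul] at h
  have h1 : t ∈ (a : Ideal (QuadOrder m)) * b := by
    rw [h]; exact Ideal.mem_span_singleton_self t
  exact Ideal.mul_le_right h1

/-- Ideals in the inverse of the class of `b` correspond to elements of `unitSet b`. -/
theorem exists_equiv_unitSet (b : coprimeIdeals (modulus m)) {k : RayGroup (modulus m)}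
    (hk : k * cls b = 1) :
    ∃ e : {a : coprimeIdeals (modulus m) // cls a = k} ≃ unitSet (b : Ideal (QuadOrder m)),
      ∀ a, (a.1 : Ideal (QuadOrder m)) * b = Ideal.span {(e a : QuadOrder m)} := by
  have hex : ∀ a : {a : coprimeIdeals (modulus m) // cls a = k},
      ∃ z : unitSet (b : Ideal (QuadOrder m)),
        (a.1 : Ideal (QuadOrder m)) * b = Ideal.span {(z : QuadOrder m)} := fun a =>
    exists_unitSet_of_cls_mul (by rw [a.2, hk])
  choose f hf using hex
  refine ⟨Equiv.ofBijective f ⟨fun a a' h => ?_, fun z => ?_⟩, hf⟩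
  · have h1 := hf a
    rw [h, ← hf a'] at h1
    exact Subtype.ext (Subtype.ext (mul_right_cancel₀ (coprime_ne_bot b.2) h1))
  · obtain ⟨a, ha⟩ := exists_mul_eq_span z.2.2 z.2.1
    have ha' : cls a = k := by
      have h1 : cls (b * a) = 1 := by
        rw [← cls_span z.2.1]
        congr 1
        exact Subtype.ext ha
      rw [cls_mul] at h1
      rw [mul_comm] at hk
      exact mul_left_cancel (h1.trans hk.symm)
    refine ⟨⟨a, ha'⟩, Subtype.ext ?_⟩
    refine eq_of_span_eq (f ⟨a, ha'⟩).2.1 z.2.1 ?_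
    rw [← hf, ← ha, mul_comm]

theorem classSum_eq (b : coprimeIdeals (modulus m)) {k : RayGroup (modulus m)}
    (hk : k * cls b = 1) {s : ℝ} :
    classSum k s = (((Ideal.absNorm (b : Ideal (QuadOrder m)) : ℝ) ^ s : ℝ) : ℂ) *
      unitSeries (b : Ideal (QuadOrder m)) s := by
  classical
  obtain ⟨e, he⟩ := exists_equiv_unitSet b hk
  have hb : (0 : ℝ) < Ideal.absNorm (b : Ideal (QuadOrder m)) := by
    exact_mod_cast Nat.pos_of_ne_zero (Ideal.absNorm_eq_zero_iff.not.2 (coprime_ne_bot b.2))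
  rw [unitSeries_eq, ← e.tsum_eq, ← tsum_mul_left, classSum]
  refine (tsum_ite_eq_tsum_subtype (fun a : coprimeIdeals (modulus m) => cls a = k)
    fun a => ((((Ideal.absNorm (a : Ideal (QuadOrder m)) : ℝ) ^ (-s) : ℝ)) : ℂ)).trans ?_
  refine tsum_congr fun a => ?_
  rw [← absNorm_span_eq, ← he, map_mul, Nat.cast_mul,
    Real.mul_rpow (by positivity) (by positivity), ← Complex.ofReal_mul, mul_left_comm,
    ← Real.rpow_add hb]
  simp

theorem summable_absNorm {s : ℝ} (hs : 1 < s) : Summable fun a : coprimeIdeals (modulus m) =>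
    (Ideal.absNorm (a : Ideal (QuadOrder m)) : ℝ) ^ (-s) := by
  classical
  have : Fintype (RayGroup (modulus m)) := Fintype.ofFinite _
  have hm : 0 < m := by linarith [h3.out]
  have h : ∀ k : RayGroup (modulus m), Summable fun a : coprimeIdeals (modulus m) =>
      if cls a = k then (Ideal.absNorm (a : Ideal (QuadOrder m)) : ℝ) ^ (-s) else 0 := by
    intro k
    obtain ⟨b, hb⟩ := cls_surjective k⁻¹
    have hk : k * cls b = 1 := by rw [hb, mul_inv_cancel]
    obtain ⟨e, he⟩ := exists_equiv_unitSet b hk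
    have hb : (0 : ℝ) < Ideal.absNorm (b : Ideal (QuadOrder m)) := by
      exact_mod_cast Nat.pos_of_ne_zero (Ideal.absNorm_eq_zero_iff.not.2 (coprime_ne_bot b.2))
    have h1 := (e.summable_iff.2 ((summable_norm_rpow hm hs).subtype
      (unitSet (b : Ideal (QuadOrder m))))).mul_left
        ((Ideal.absNorm (b : Ideal (QuadOrder m)) : ℝ) ^ s)
    refine summable_ite_of_summable_subtype _ _ (h1.congr fun a => ?_)
    simp only [Function.comp]
    rw [← absNorm_span_eq, ← he, map_mul, Nat.cast_mul,
      Real.mul_rpow (by positivity) (by positivity), mul_left_comm, ← Real.rpow_add hb]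
    simp
  refine (summable_sum fun k (_ : k ∈ Finset.univ) => h k).congr fun a => ?_
  simp

end QuadOrder

namespace QuadOrder

open scoped QuadraticAlgebra
open RayClass

local notation "𝒩" => QuadraticAlgebra.norm

variable {m : ℤ}

theorem normSeries_sum (hm : 0 < m) {ι : Type*} (t : Finset ι) {φ : ι → QuadOrder m → ℂ}
    (hφ : ∀ i z, ‖φ i z‖ ≤ 1) {s : ℝ} (hs : 1 < s) :
    normSeries (fun z => ∑ i ∈ t, φ i z) s = ∑ i ∈ t, normSeries (φ i) s := by
  simp only [normSeries]
  rw [← Summable.tsum_finsetSum fun i _ => summable_normSeries hm (hφ i) hs]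
  exact tsum_congr fun z => Finset.sum_mul _ _ _

theorem exists_mem_modulus_mk_eq {b : Ideal (QuadOrder m)} (hb : b ∈ coprimeIdeals (modulus m))
    (x : QuadOrder m ⧸ b) : ∃ w ∈ modulus m, Ideal.Quotient.mk b w = x := by
  obtain ⟨t, htb, ht⟩ := exists_mem_of_mem_coprimeIdeals hb
  obtain ⟨r, rfl⟩ := Ideal.Quotient.mk_surjective x
  refine ⟨-r * (t - 1), Ideal.mul_mem_left _ _ ht, ?_⟩
  rw [Ideal.Quotient.mk_eq_mk_iff_sub_mem]
  have : -r * (t - 1) - r = -r * t := by ring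
  rw [this]
  exact Ideal.mul_mem_left _ _ htb

theorem sum_indicator_unitSet {b : Ideal (QuadOrder m)} [Fintype (QuadOrder m ⧸ b)]
    {w : QuadOrder m ⧸ b → QuadOrder m} (hw : ∀ x, w x ∈ modulus m)
    (hwx : ∀ x, Ideal.Quotient.mk b (w x) = x) (z : QuadOrder m) :
    ∑ x, (unitSet b).indicator (1 : QuadOrder m → ℂ) (z + w x) =
      (unitSet (⊤ : Ideal (QuadOrder m))).indicator 1 z := by
  classical
  have h1 : ∀ x, z + w x - 1 ∈ modulus m ↔ z - 1 ∈ modulus m := fun x => by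
    rw [show z + w x - 1 = z - 1 + w x by ring]
    exact (modulus m).add_mem_iff_left (hw x)
  have h2 : ∀ x, z + w x ∈ b ↔ x = -Ideal.Quotient.mk b z := fun x => by
    rw [← Ideal.Quotient.eq_zero_iff_mem, map_add, hwx, eq_neg_iff_add_eq_zero, add_comm]
  simp only [Set.indicator_apply, unitSet, Set.mem_ofPred_eq, h1, h2, Submodule.mem_top, and_true,
    Pi.one_apply]
  by_cases h : z - 1 ∈ modulus m <;> simp [h]

variable [h3 : Fact (3 ≤ m)] [hq : Fact (Prime (4 * m - 1))]

theorem regularAtOne_unitSeries {b : Ideal (QuadOrder m)} (hb : b ∈ coprimeIdeals (modulus m)) :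
    RegularAtOne fun s => (Ideal.absNorm b : ℂ) * unitSeries b s -
      unitSeries (⊤ : Ideal (QuadOrder m)) s := by
  have hm : 0 < m := by linarith [h3.out]
  have : Finite (QuadOrder m ⧸ b) :=
    Ideal.absNorm_ne_zero_iff b |>.1 (Ideal.absNorm_eq_zero_iff.not.2 (coprime_ne_bot hb))
  have : Fintype (QuadOrder m ⧸ b) := Fintype.ofFinite _
  choose w hw hwx using exists_mem_modulus_mk_eq hb
  refine (RegularAtOne.sum Finset.univ fun x _ =>
    regularAtOne_shift hm (norm_indicator_le (unitSet b)) (w x)).congr ?_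
  filter_upwards [self_mem_nhdsWithin] with s hs
  rw [Finset.sum_sub_distrib, ← normSeries_sum hm _
    (φ := fun x z => (unitSet b).indicator 1 (z + w x)) (fun x z => norm_indicator_le _ _) hs]
  simp only [sum_indicator_unitSet hw hwx]
  rw [Finset.sum_const, Finset.card_univ, nsmul_eq_mul]
  rw [Ideal.absNorm_apply, Submodule.cardQuot_apply, Nat.card_eq_fintype_card]
  rfl

theorem classSum_one (s : ℝ) : classSum (1 : RayGroup (modulus m)) s =
    unitSeries (⊤ : Ideal (QuadOrder m)) s := by
  have := classSum_eq (1 : coprimeIdeals (modulus m)) (k := 1) (by rw [cls_one, one_mul]) (s := s)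
  rw [this, Submonoid.coe_one, Ideal.one_eq_top]
  simp

theorem regularAtOne_sub_mul_classSum (k : RayGroup (modulus m)) :
    ∃ n : ℕ, 0 < n ∧ RegularAtOne fun s => classSum k s -
      ((n : ℝ) ^ (s - 1) : ℝ) * classSum (1 : RayGroup (modulus m)) s := by
  obtain ⟨b, hb⟩ := cls_surjective k⁻¹
  have hk : k * cls b = 1 := by rw [hb, mul_inv_cancel]
  have hn : 0 < Ideal.absNorm (b : Ideal (QuadOrder m)) :=
    Nat.pos_of_ne_zero (Ideal.absNorm_eq_zero_iff.not.2 (coprime_ne_bot b.2))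
  have hn' : (0 : ℝ) < Ideal.absNorm (b : Ideal (QuadOrder m)) := by exact_mod_cast hn
  refine ⟨_, hn, ((RegularAtOne.rpow_sub_one hn').mul (regularAtOne_unitSeries b.2)).congr
    (Eventually.of_forall fun s => ?_)⟩
  rw [classSum_eq b hk, classSum_one, mul_sub, ← mul_assoc]
  congr 2
  have hne := hn'.ne'
  rw [Real.rpow_sub_one hne, ← Complex.ofReal_natCast, ← Complex.ofReal_mul,
    div_mul_cancel₀ _ hne]

/-- `s = 1` is at most a simple pole of the partial zeta functions. -/
theorem regularAtOne_mul_classSum :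
    RegularAtOne fun s => (s - 1) * classSum (1 : RayGroup (modulus m)) s := by
  have hβ : 1 + 2 * disc m - 1 ∈ modulus m := by
    rw [add_sub_cancel_left]; exact Ideal.mem_span_singleton_self _
  let b : coprimeIdeals (modulus m) := ⟨_, span_mem_coprimeIdeals hβ⟩
  have hk : (1 : RayGroup (modulus m)) * cls b = 1 := by rw [cls_span hβ, one_mul]
  have hn : (1 : ℝ) < Ideal.absNorm (b : Ideal (QuadOrder m)) := by
    have h1 : (1 + 2 * disc m : QuadOrder m) = ⟨-1, 4⟩ := by ext <;> simp [disc]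
    have h2 : (1 : ℤ) < 𝒩 (1 + 2 * disc m) := by
      rw [nm_eq, h1]; linarith [h3.out]
    rw [absNorm_span_eq]
    exact_mod_cast h2
  have hn0 : (0 : ℝ) < Ideal.absNorm (b : Ideal (QuadOrder m)) := by linarith
  refine ((RegularAtOne.div_rpow_sub_one (inv_pos.2 hn0) (by simpa using hn.ne')).mul
    (regularAtOne_unitSeries b.2)).congr ?_
  filter_upwards [self_mem_nhdsWithin] with s hs
  have hs : 1 < s := hs
  have e := classSum_eq b hk (s := s)
  rw [← classSum_one]
  set n : ℝ := (Ideal.absNorm (b : Ideal (QuadOrder m)) : ℝ) with hndef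
  have hns : ((n ^ s : ℝ) : ℂ) ≠ 0 := by exact_mod_cast (Real.rpow_pos_of_pos hn0 s).ne'
  have hnn : (Ideal.absNorm (b : Ideal (QuadOrder m)) : ℂ) = (n : ℂ) := by
    rw [hndef]; push_cast; rfl
  have hu : unitSeries (b : Ideal (QuadOrder m)) s = ((n ^ s : ℝ) : ℂ)⁻¹ *
      classSum (1 : RayGroup (modulus m)) s := by
    rw [e, inv_mul_cancel_left₀ hns]
  have hp : (n⁻¹ ^ (s - 1) : ℝ) = n * (n ^ s)⁻¹ := by
    rw [Real.inv_rpow hn0.le, Real.rpow_sub_one hn0.ne', inv_div, div_eq_mul_inv]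
  have hlt : (n⁻¹ ^ (s - 1) : ℝ) < 1 :=
    Real.rpow_lt_one (by positivity) (inv_lt_one_of_one_lt₀ hn) (by linarith)
  have hne : ((n⁻¹ ^ (s - 1) : ℝ) : ℂ) - 1 ≠ 0 := by
    rw [sub_ne_zero]; exact_mod_cast hlt.ne
  rw [hnn, hu]
  have : (n : ℂ) * (((n ^ s : ℝ) : ℂ)⁻¹ * classSum (1 : RayGroup (modulus m)) s) -
      classSum (1 : RayGroup (modulus m)) s =
      (((n⁻¹ ^ (s - 1) : ℝ) : ℂ) - 1) * classSum (1 : RayGroup (modulus m)) s := by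
    rw [hp]; push_cast; ring
  rw [this, ← mul_assoc, div_mul_cancel₀ _ hne]

theorem regularAtOne_classSum_sub (k : RayGroup (modulus m)) :
    RegularAtOne fun s => classSum k s - classSum (1 : RayGroup (modulus m)) s := by
  obtain ⟨n, hn, h⟩ := regularAtOne_sub_mul_classSum k
  have hn' : (0 : ℝ) < n := by exact_mod_cast hn
  refine (h.add ((RegularAtOne.rpow_sub_one_div hn').mul (regularAtOne_mul_classSum
    (m := m)))).congr ?_
  filter_upwards [self_mem_nhdsWithin] with s hs
  have hs : 1 < s := hs
  have : (s : ℂ) - 1 ≠ 0 := by rw [sub_ne_zero]; exact_mod_cast hs.ne'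
  field_simp
  ring

end QuadOrder

namespace QuadOrder

open scoped QuadraticAlgebra
open RayClass

local notation "𝒩" => QuadraticAlgebra.norm

variable {m : ℤ}

variable (m) in
/-- A two-parameter family of elements congruent to `1`, enumerated by the pairing function. -/
def unitSeq (n : ℕ) : QuadOrder m :=
  ⟨1 + 2 * (4 * m - 1) * (Nat.unpair n).1, 2 * (4 * m - 1) * (Nat.unpair n).2⟩

theorem unitSeq_mem (n : ℕ) : unitSeq m n ∈ unitSet (⊤ : Ideal (QuadOrder m)) := by
  refine ⟨mem_modulus.2 ⟨⟨(4 * m - 1) * (Nat.unpair n).1, ?_⟩,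
    ⟨(4 * m - 1) * (Nat.unpair n).2, ?_⟩,
    ⟨2 * (2 * (Nat.unpair n).1 + (Nat.unpair n).2), ?_⟩⟩, Submodule.mem_top⟩ <;>
  simp [unitSeq] <;> ring

theorem unitSeq_injective (hm : 0 < m) : Function.Injective (unitSeq m) := by
  intro a b h
  have hq : 2 * (4 * m - 1) ≠ 0 := by linarith
  have h1 := congrArg QuadraticAlgebra.re h
  have h2 := congrArg QuadraticAlgebra.im h
  simp only [unitSeq, add_right_inj, mul_right_inj' hq, Nat.cast_inj] at h1 h2
  rw [← Nat.pair_unpair a, ← Nat.pair_unpair b, h1, h2]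

theorem exists_nm_unitSeq_le (hm : 0 < m) :
    ∃ C > 0, ∀ n, 𝒩 (unitSeq m n) ≤ C * ((n : ℤ) + 1) := by
  set q := 4 * m - 1 with hq
  refine ⟨2 * (2 + 8 * q ^ 2) + (m + 1) * (4 * q ^ 2), by positivity, fun n => ?_⟩
  have h := Nat.max_sq_add_min_le_pair (Nat.unpair n).1 (Nat.unpair n).2
  rw [Nat.pair_unpair] at h
  rw [nm_eq]
  simp only [unitSeq]
  have hi : ((Nat.unpair n).1 : ℤ) ^ 2 ≤ n := by
    have : (Nat.unpair n).1 ^ 2 ≤ max (Nat.unpair n).1 (Nat.unpair n).2 ^ 2 :=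
      Nat.pow_le_pow_left (le_max_left _ _) 2
    exact_mod_cast (this.trans (Nat.le_add_right _ _)).trans h
  have hj : ((Nat.unpair n).2 : ℤ) ^ 2 ≤ n := by
    have : (Nat.unpair n).2 ^ 2 ≤ max (Nat.unpair n).1 (Nat.unpair n).2 ^ 2 :=
      Nat.pow_le_pow_left (le_max_right _ _) 2
    exact_mod_cast (this.trans (Nat.le_add_right _ _)).trans h
  set i : ℤ := ((Nat.unpair n).1 : ℤ)
  set j : ℤ := ((Nat.unpair n).2 : ℤ)
  have h1 : (1 + 2 * q * i) ^ 2 ≤ (2 + 8 * q ^ 2) * (n + 1) := by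
    have := mul_le_mul_of_nonneg_left hi (by positivity : 0 ≤ 8 * q ^ 2)
    nlinarith [sq_nonneg (1 - 2 * q * i), sq_nonneg q]
  have h2 : (2 * q * j) ^ 2 ≤ 4 * q ^ 2 * (n + 1) := by
    have := mul_le_mul_of_nonneg_left hj (by positivity : 0 ≤ 4 * q ^ 2)
    nlinarith [sq_nonneg q]
  have h4 : (m + 1) * (2 * q * j) ^ 2 ≤ (m + 1) * (4 * q ^ 2 * (n + 1)) := by gcongr
  nlinarith [sq_nonneg (1 + 2 * q * i - 2 * q * j), sq_nonneg (1 + 2 * q * i),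
    sq_nonneg (2 * q * j)]

theorem not_summable_unitSet (hm : 0 < m) :
    ¬ Summable fun z : unitSet (⊤ : Ideal (QuadOrder m)) =>
      ((𝒩 (z : QuadOrder m) : ℤ) : ℝ) ^ (-1 : ℝ) := by
  intro h
  have hinj : Function.Injective fun n => (⟨unitSeq m n, unitSeq_mem n⟩ :
      unitSet (⊤ : Ideal (QuadOrder m))) := fun a b hab =>
    unitSeq_injective hm (congrArg Subtype.val hab)
  have h1 := h.comp_injective hinj
  obtain ⟨C, hC, hb⟩ := exists_nm_unitSeq_le hm
  have hC' : (0 : ℝ) < C := by exact_mod_cast hC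
  have h2 : Summable fun n : ℕ => (((n + 1 : ℕ) : ℝ))⁻¹ := by
    refine Summable.of_nonneg_of_le (fun n => by positivity) (fun n => ?_) (h1.mul_left (C : ℝ))
    have hz : unitSeq m n ≠ 0 := fun h0 => by
      have h1 := (unitSeq_mem (m := m) n).1
      have hre := congrArg QuadraticAlgebra.re h0
      simp only [unitSeq, QuadraticAlgebra.re_zero] at hre
      have : (2 : ℤ) ∣ 1 := ⟨-((4 * m - 1) * (Nat.unpair n).1), by linarith⟩
      norm_num at this
    have hpos := one_le_nm hm hz
    have hbn : ((𝒩 (unitSeq m n) : ℤ) : ℝ) ≤ C * ((n : ℝ) + 1) := by exact_mod_cast hb n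
    simp only [Function.comp]
    rw [Real.rpow_neg_one, ← div_eq_mul_inv, le_div_iff₀ (by linarith), inv_mul_le_iff₀
      (by positivity)]
    push_cast
    linarith
  exact Real.not_summable_natCast_inv ((summable_nat_add_iff 1).1 h2)

theorem not_eventually_unitSeries_le (hm : 0 < m) (C : ℝ) :
    ¬ ∀ᶠ s : ℝ in 𝓝[>] 1, ‖unitSeries (⊤ : Ideal (QuadOrder m)) s‖ ≤ C := by
  intro h
  have h0 : ∀ (z : QuadOrder m) (s : ℝ), 0 ≤ ((𝒩 z : ℤ) : ℝ) ^ s := fun z s =>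
    Real.rpow_nonneg (by exact_mod_cast nm_nonneg hm z) s
  refine not_summable_unitSet hm (summable_of_sum_le (c := C) (fun z => h0 _ _) fun T => ?_)
  have hlim : Tendsto (fun s : ℝ => ∑ z ∈ T, ((𝒩 (z : QuadOrder m) : ℤ) : ℝ) ^ (-s)) (𝓝[>] 1)
      (𝓝 (∑ z ∈ T, ((𝒩 (z : QuadOrder m) : ℤ) : ℝ) ^ (-1 : ℝ))) := by
    refine tendsto_finsetSum _ fun z _ => Tendsto.mono_left ?_ nhdsWithin_le_nhds
    exact ((Real.continuousAt_const_rpow' (by norm_num)).comp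
      (continuous_neg.continuousAt (x := (1 : ℝ)))).tendsto
  refine le_of_tendsto hlim ?_
  filter_upwards [h, self_mem_nhdsWithin] with s hs hs1
  refine le_trans ?_ hs
  rw [unitSeries_eq, ← Complex.ofReal_tsum, Complex.norm_real,
    Real.norm_of_nonneg (tsum_nonneg fun z => h0 _ _)]
  exact ((summable_norm_rpow hm hs1).subtype _).sum_le_tsum T fun z _ => h0 _ _

variable [h3 : Fact (3 ≤ m)] [hq : Fact (Prime (4 * m - 1))]

noncomputable instance : Fintype (RayGroup (modulus m)) := Fintype.ofFinite _

/-- The `L`-series of a ray class character. -/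
noncomputable def lSeries (ψ : AddChar (Additive (RayGroup (modulus m))) ℂ) (s : ℝ) : ℂ :=
  ∑ k, ψ (Additive.ofMul k) * classSum k s

variable {ψ : AddChar (Additive (RayGroup (modulus m))) ℂ}

theorem regularAtOne_lSeries_sub (ψ : AddChar (Additive (RayGroup (modulus m))) ℂ) :
    RegularAtOne fun s => lSeries ψ s -
      (∑ k, ψ k) * classSum (1 : RayGroup (modulus m)) s := by
  refine (RegularAtOne.sum Finset.univ fun k _ =>
    (regularAtOne_classSum_sub k).const_mul (ψ (Additive.ofMul k))).congr
    (Eventually.of_forall fun s => ?_)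
  have : ∑ k, ψ k = ∑ k : RayGroup (modulus m), ψ (Additive.ofMul k) :=
    (Equiv.sum_comp Additive.ofMul _).symm
  simp only [mul_sub, Finset.sum_sub_distrib, ← Finset.sum_mul]
  rw [this, lSeries]

theorem regularAtOne_lSeries (hψ : ψ ≠ 0) : RegularAtOne (lSeries ψ) := by
  have h := regularAtOne_lSeries_sub ψ
  rw [AddChar.sum_eq_zero_iff_ne_zero.2 hψ] at h
  simpa using h

theorem regularAtOne_mul_lSeries_zero : RegularAtOne fun s =>
    (s - 1) * lSeries (0 : AddChar (Additive (RayGroup (modulus m))) ℂ) s := by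
  have h1 : RegularAtOne fun s : ℝ => (s : ℂ) - 1 :=
    ⟨fun s => s - 1, by fun_prop, Eventually.of_forall fun s => rfl⟩
  refine ((h1.mul (regularAtOne_lSeries_sub (0 : AddChar (Additive (RayGroup (modulus m))) ℂ))).add
    ((regularAtOne_mul_classSum (m := m)).const_mul
      (∑ k, (0 : AddChar (Additive (RayGroup (modulus m))) ℂ) k))).congr
    (Eventually.of_forall fun s => ?_)
  ring

/-- The `L`-series of the trivial character has a simple pole at `1`. -/
theorem exists_log_lSeries_zero : ∃ C : ℝ, ∀ᶠ s : ℝ in 𝓝[>] 1,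
    |Real.log ‖lSeries (0 : AddChar (Additive (RayGroup (modulus m))) ℂ) s‖ +
      Real.log (s - 1)| ≤ C := by
  have hm : 0 < m := by linarith [h3.out]
  have hnorm : ∀ s : ℝ, 1 < s → ∀ z : ℂ, ‖((s : ℂ) - 1) * z‖ = (s - 1) * ‖z‖ := fun s hs z => by
    rw [← Complex.ofReal_one, ← Complex.ofReal_sub, norm_mul, Complex.norm_real,
      Real.norm_of_nonneg (by linarith)]
  have hreg := regularAtOne_mul_lSeries_zero (m := m)
  obtain ⟨C, hC⟩ := hreg.eventually_le
  rcases hreg.eventually_ge_or_le with ⟨c, hc0, hc⟩ | ⟨D, hD0, hD⟩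
  · refine ⟨max (Real.log C) (-Real.log c), ?_⟩
    filter_upwards [hC, hc, self_mem_nhdsWithin] with s h1 h2 hs
    have hs : 1 < s := hs
    rw [hnorm s hs] at h1 h2
    have hpos : 0 < (s - 1) * ‖lSeries (0 : AddChar (Additive (RayGroup (modulus m))) ℂ) s‖ := by
      linarith
    have hpos' := pos_of_mul_pos_right hpos (by linarith)
    rw [← Real.log_mul hpos'.ne' (by linarith), mul_comm, abs_le]
    constructor
    · have := Real.log_le_log hc0 h2
      linarith [le_max_right (Real.log C) (-Real.log c)]
    · exact (Real.log_le_log hpos h1).trans (le_max_left _ _)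
  · exfalso
    obtain ⟨B, hB⟩ := (regularAtOne_lSeries_sub
      (0 : AddChar (Additive (RayGroup (modulus m))) ℂ)).eventually_le
    have hsum : ∑ k, (0 : AddChar (Additive (RayGroup (modulus m))) ℂ) k =
        (Fintype.card (Additive (RayGroup (modulus m))) : ℂ) := by simp
    have hcard : (1 : ℝ) ≤ Fintype.card (Additive (RayGroup (modulus m))) := by
      exact_mod_cast Fintype.card_pos
    refine not_eventually_unitSeries_le hm (D + B) ?_
    filter_upwards [hD, hB, self_mem_nhdsWithin] with s h1 h2 hs
    have hs : 1 < s := hs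
    rw [hnorm s hs, mul_comm] at h1
    have h1 := le_of_mul_le_mul_right h1 (by linarith)
    rw [hsum] at h2
    rw [← classSum_one]
    have h5 := norm_sub_norm_le ((Fintype.card (Additive (RayGroup (modulus m))) : ℂ) *
      classSum (1 : RayGroup (modulus m)) s)
      (lSeries (0 : AddChar (Additive (RayGroup (modulus m))) ℂ) s)
    rw [norm_sub_rev, norm_mul, Complex.norm_natCast] at h5
    nlinarith [norm_nonneg (classSum (1 : RayGroup (modulus m)) s)]

theorem exists_log_lSeries_le (hψ : ψ ≠ 0) (h0 : ∀ s > 1, lSeries ψ s ≠ 0) :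
    ∃ C : ℝ, ∀ᶠ s : ℝ in 𝓝[>] 1, Real.log ‖lSeries ψ s‖ ≤ C := by
  obtain ⟨C, hC⟩ := (regularAtOne_lSeries hψ).eventually_le
  refine ⟨Real.log C, ?_⟩
  filter_upwards [hC, self_mem_nhdsWithin] with s h hs
  exact Real.log_le_log (norm_pos_iff.2 (h0 s hs)) h

/-- The `L`-series of a nontrivial character is either bounded away from zero near `1` or has a
zero at `1`. -/
theorem exists_log_lSeries_ge_or_le (hψ : ψ ≠ 0) (h0 : ∀ s > 1, lSeries ψ s ≠ 0) :
    (∃ C : ℝ, ∀ᶠ s : ℝ in 𝓝[>] 1, C ≤ Real.log ‖lSeries ψ s‖) ∨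
      ∃ C : ℝ, ∀ᶠ s : ℝ in 𝓝[>] 1, Real.log ‖lSeries ψ s‖ ≤ C + Real.log (s - 1) := by
  refine (regularAtOne_lSeries hψ).eventually_ge_or_le.imp ?_ ?_
  · rintro ⟨c, hc0, hc⟩
    exact ⟨Real.log c, by filter_upwards [hc] with s h using Real.log_le_log hc0 h⟩
  · rintro ⟨D, hD0, hD⟩
    refine ⟨Real.log D, ?_⟩
    filter_upwards [hD, self_mem_nhdsWithin] with s h hs
    have hs : 1 < s := hs
    rw [← Real.log_mul hD0.ne' (by linarith)]
    exact Real.log_le_log (norm_pos_iff.2 (h0 s hs)) h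

end QuadOrder

namespace QuadOrder

open scoped QuadraticAlgebra
open RayClass

variable {m : ℤ}

instance : Countable (QuadOrder m) :=
  (QuadraticAlgebra.linearEquivTuple (-m) 1).injective.countable

variable [h3 : Fact (3 ≤ m)] [hq : Fact (Prime (4 * m - 1))]

instance : Countable (Ideal (QuadOrder m)) := by
  refine Function.Surjective.countable
    (f := fun t : Finset (QuadOrder m) => Ideal.span (t : Set (QuadOrder m))) fun a => ?_
  exact (isNoetherianRing_iff_ideal_fg _).1 inferInstance a

open Classical in
/-- The function on ideals attached to a ray class character. -/
noncomputable def idealFun (ψ : AddChar (Additive (RayGroup (modulus m))) ℂ) (s : ℝ)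
    (a : Ideal (QuadOrder m)) : ℂ :=
  if h : a ∈ coprimeIdeals (modulus m) then
    ψ (Additive.ofMul (cls ⟨a, h⟩)) * (((Ideal.absNorm a : ℝ) ^ (-s) : ℝ) : ℂ) else 0

theorem idealFun_coe (ψ : AddChar (Additive (RayGroup (modulus m))) ℂ) (s : ℝ)
    (a : coprimeIdeals (modulus m)) :
    idealFun ψ s (a : Ideal (QuadOrder m)) = ψ (Additive.ofMul (cls a)) *
      (((Ideal.absNorm (a : Ideal (QuadOrder m)) : ℝ) ^ (-s) : ℝ) : ℂ) :=
  dif_pos a.2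

theorem idealFun_coe_mul (ψ : AddChar (Additive (RayGroup (modulus m))) ℂ) (s : ℝ)
    (a b : coprimeIdeals (modulus m)) :
    idealFun ψ s (a * b : Ideal (QuadOrder m)) =
      idealFun ψ s (a : Ideal (QuadOrder m)) * idealFun ψ s (b : Ideal (QuadOrder m)) := by
  rw [← Submonoid.coe_mul, idealFun_coe, idealFun_coe, idealFun_coe, cls_mul, ofMul_mul,
    AddChar.map_add_eq_mul, Submonoid.coe_mul, map_mul, Nat.cast_mul,
    Real.mul_rpow (Nat.cast_nonneg _) (Nat.cast_nonneg _)]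
  push_cast
  ring

/-- The completely multiplicative function on ideals attached to a ray class character. -/
noncomputable def idealChar (ψ : AddChar (Additive (RayGroup (modulus m))) ℂ) (s : ℝ) :
    Ideal (QuadOrder m) →*₀ ℂ where
  toFun := idealFun ψ s
  map_zero' := dif_neg fun h => coprime_ne_bot h rfl
  map_one' := by
    have h := idealFun_coe ψ s 1
    rw [cls_one, Submonoid.coe_one, ofMul_one, AddChar.map_zero_eq_one, map_one, Nat.cast_one,
      Real.one_rpow, Complex.ofReal_one, one_mul] at h
    exact h
  map_mul' a b := by
    by_cases ha : a ∈ coprimeIdeals (modulus m)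
    · by_cases hb : b ∈ coprimeIdeals (modulus m)
      · exact idealFun_coe_mul ψ s ⟨a, ha⟩ ⟨b, hb⟩
      · have h : a * b ∉ coprimeIdeals (modulus m) := fun h => hb (IsCoprime.mul_left_iff.1 h).2
        rw [idealFun, idealFun, idealFun, dif_neg h, dif_neg hb, mul_zero]
    · have h : a * b ∉ coprimeIdeals (modulus m) := fun h => ha (IsCoprime.mul_left_iff.1 h).1
      rw [idealFun, idealFun, idealFun, dif_neg h, dif_neg ha, zero_mul]

variable {ψ : AddChar (Additive (RayGroup (modulus m))) ℂ} {s : ℝ}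

theorem idealChar_coe (a : coprimeIdeals (modulus m)) :
    idealChar ψ s (a : Ideal (QuadOrder m)) = ψ (Additive.ofMul (cls a)) *
      (((Ideal.absNorm (a : Ideal (QuadOrder m)) : ℝ) ^ (-s) : ℝ) : ℂ) :=
  dif_pos a.2

theorem idealChar_of_notMem {a : Ideal (QuadOrder m)} (ha : a ∉ coprimeIdeals (modulus m)) :
    idealChar ψ s a = 0 :=
  dif_neg ha

theorem norm_idealChar_coe (a : coprimeIdeals (modulus m)) :
    ‖idealChar ψ s (a : Ideal (QuadOrder m))‖ =
      (Ideal.absNorm (a : Ideal (QuadOrder m)) : ℝ) ^ (-s) := by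
  rw [idealChar_coe, norm_mul, AddChar.norm_apply, one_mul, Complex.norm_real,
    Real.norm_of_nonneg (Real.rpow_nonneg (Nat.cast_nonneg _) _)]

theorem norm_idealChar_of_mem (ψ : AddChar (Additive (RayGroup (modulus m))) ℂ) (s : ℝ)
    {a : Ideal (QuadOrder m)} (ha : a ∈ coprimeIdeals (modulus m)) :
    ‖idealChar ψ s a‖ = (Ideal.absNorm a : ℝ) ^ (-s) :=
  norm_idealChar_coe ⟨a, ha⟩

theorem two_le_absNorm {𝔭 : Ideal (QuadOrder m)} (h : Prime 𝔭) : 2 ≤ Ideal.absNorm 𝔭 := by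
  have h0 : Ideal.absNorm 𝔭 ≠ 0 := fun h' => h.ne_zero (Ideal.absNorm_eq_zero_iff.1 h')
  have h1 : Ideal.absNorm 𝔭 ≠ 1 := fun h' => h.not_isUnit (by
    rw [Ideal.absNorm_eq_one_iff.1 h', ← Ideal.one_eq_top]; exact isUnit_one)
  omega

theorem norm_idealChar_le_inv (ψ : AddChar (Additive (RayGroup (modulus m))) ℂ) (hs : 1 < s)
    {𝔭 : Ideal (QuadOrder m)} (h𝔭 : Prime 𝔭) :
    ‖idealChar ψ s 𝔭‖ ≤ (Ideal.absNorm 𝔭 : ℝ)⁻¹ := by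
  by_cases h : 𝔭 ∈ coprimeIdeals (modulus m)
  · rw [norm_idealChar_of_mem ψ s h, ← Real.rpow_neg_one]
    have : (2 : ℝ) ≤ Ideal.absNorm 𝔭 := by exact_mod_cast two_le_absNorm h𝔭
    exact Real.rpow_le_rpow_of_exponent_le (by linarith) (by linarith)
  · rw [idealChar_of_notMem h, norm_zero]
    positivity

theorem summable_norm_idealChar (ψ : AddChar (Additive (RayGroup (modulus m))) ℂ) (hs : 1 < s) :
    Summable fun a => ‖idealChar ψ s a‖ := by
  rw [← (Subtype.val_injective (p := (· ∈ coprimeIdeals (modulus m)))).summable_iff]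
  · exact (summable_absNorm hs).congr fun a => (norm_idealChar_coe a).symm
  · intro a ha
    rw [idealChar_of_notMem fun h => ha ⟨⟨a, h⟩, rfl⟩, norm_zero]

theorem tsum_idealChar (hs : 1 < s) : ∑' a, idealChar ψ s a = lSeries ψ s := by
  classical
  have hsupp : Function.support (idealChar ψ s) ⊆
      Set.range (Subtype.val : coprimeIdeals (modulus m) → Ideal (QuadOrder m)) := fun a ha => by
    by_contra h
    exact ha (idealChar_of_notMem fun h' => h ⟨⟨a, h'⟩, rfl⟩)
  rw [← Subtype.val_injective.tsum_eq hsupp, lSeries]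
  simp only [classSum, ← tsum_mul_left]
  rw [← Summable.tsum_finsetSum]
  · refine tsum_congr fun a => ?_
    rw [idealChar_coe]
    simp
  · intro k _
    refine Summable.of_norm_bounded (summable_absNorm hs) fun a => ?_
    rw [norm_mul, AddChar.norm_apply, one_mul]
    split_ifs
    · rw [Complex.norm_real, Real.norm_of_nonneg (Real.rpow_nonneg (Nat.cast_nonneg _) _)]
    · simpa using Real.rpow_nonneg (Nat.cast_nonneg _) _

theorem lSeries_ne_zero (hs : 1 < s) : lSeries ψ s ≠ 0 := by
  rw [← tsum_idealChar hs,
    ← IdealEulerProduct.exp_tsum_log_eq_tsum (summable_norm_idealChar ψ hs)]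
  exact Complex.exp_ne_zero _

/-- The sum over prime ideals attached to a ray class character. -/
noncomputable def primeSum (ψ : AddChar (Additive (RayGroup (modulus m))) ℂ) (s : ℝ) : ℝ :=
  (∑' 𝔭 : {𝔭 : Ideal (QuadOrder m) // Prime 𝔭}, idealChar ψ s 𝔭).re

theorem exists_primeSum_sub_log_le : ∃ C : ℝ,
    ∀ (ψ : AddChar (Additive (RayGroup (modulus m))) ℂ) (s : ℝ), 1 < s →
      |primeSum ψ s - Real.log ‖lSeries ψ s‖| ≤ C := by
  refine ⟨∑' 𝔭 : {𝔭 : Ideal (QuadOrder m) // Prime 𝔭},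
    ‖idealChar (0 : AddChar (Additive (RayGroup (modulus m))) ℂ) 2 𝔭‖, fun ψ s hs => ?_⟩
  have hsq : ∀ 𝔭 : {𝔭 : Ideal (QuadOrder m) // Prime 𝔭}, ‖idealChar ψ s 𝔭‖ ^ 2 ≤
      ‖idealChar (0 : AddChar (Additive (RayGroup (modulus m))) ℂ) 2 𝔭‖ := fun 𝔭 => by
    by_cases h : (𝔭 : Ideal (QuadOrder m)) ∈ coprimeIdeals (modulus m)
    · rw [norm_idealChar_of_mem 0 2 h, Real.rpow_neg (Nat.cast_nonneg _),
        Real.rpow_ofNat, ← inv_pow]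
      exact pow_le_pow_left₀ (norm_nonneg _) (norm_idealChar_le_inv ψ hs 𝔭.2) 2
    · rw [idealChar_of_notMem h, idealChar_of_notMem h]
      simp
  have hsum : Summable fun 𝔭 : {𝔭 : Ideal (QuadOrder m) // Prime 𝔭} =>
      ‖idealChar (0 : AddChar (Additive (RayGroup (modulus m))) ℂ) 2 𝔭‖ :=
    (summable_norm_idealChar _ (by norm_num)).subtype _
  have h := IdealEulerProduct.abs_re_tsum_sub_log_le (summable_norm_idealChar ψ hs) fun 𝔭 => by
    refine (norm_idealChar_le_inv ψ hs 𝔭.2).trans ?_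
    have : (2 : ℝ) ≤ Ideal.absNorm (𝔭 : Ideal (QuadOrder m)) := by
      exact_mod_cast two_le_absNorm 𝔭.2
    rw [one_div]
    exact inv_anti₀ (by norm_num) this
  rw [tsum_idealChar hs] at h
  exact h.trans ((Summable.of_nonneg_of_le (fun _ => by positivity) hsq hsum).tsum_le_tsum hsq hsum)

/-- Pairing of two ray classes, given by orthogonality of characters. -/
noncomputable def pairing (k c : RayGroup (modulus m)) : ℝ :=
  ∑ ψ : AddChar (Additive (RayGroup (modulus m))) ℂ,
    (ψ (Additive.ofMul k)).re * (ψ (Additive.ofMul c)).re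

theorem two_mul_pairing (k c : RayGroup (modulus m)) : 2 * pairing k c =
    (∑ ψ : AddChar (Additive (RayGroup (modulus m))) ℂ, ψ (Additive.ofMul (k * c))).re +
    (∑ ψ : AddChar (Additive (RayGroup (modulus m))) ℂ, ψ (Additive.ofMul (k⁻¹ * c))).re := by
  rw [pairing, Complex.re_sum, Complex.re_sum, Finset.mul_sum, ← Finset.sum_add_distrib]
  refine Finset.sum_congr rfl fun ψ _ => ?_
  rw [ofMul_mul, ofMul_mul, ofMul_inv, AddChar.map_add_eq_mul, AddChar.map_add_eq_mul,
    AddChar.map_neg_eq_conj]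
  simp
  ring

theorem pairing_nonneg (k c : RayGroup (modulus m)) : 0 ≤ pairing k c := by
  classical
  have h := two_mul_pairing k c
  rw [AddChar.sum_apply_eq_ite, AddChar.sum_apply_eq_ite] at h
  split_ifs at h <;> simp at h <;> [skip; skip; skip; exact h.ge] <;>
    linarith [(Nat.cast_nonneg (Fintype.card (RayGroup (modulus m))) : (0 : ℝ) ≤ _)]

theorem pairing_eq_zero {k c : RayGroup (modulus m)} (h1 : c ≠ k) (h2 : c ≠ k⁻¹) :
    pairing k c = 0 := by
  classical
  have h := two_mul_pairing k c
  rw [AddChar.sum_apply_eq_ite, AddChar.sum_apply_eq_ite, if_neg, if_neg] at h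
  · simpa using h
  · rw [ofMul_eq_zero, inv_mul_eq_one]
    exact h1.symm
  · rw [ofMul_eq_zero, mul_comm, mul_eq_one_iff_eq_inv]
    exact h2

theorem sum_mul_primeSum (k : RayGroup (modulus m)) (hs : 1 < s) :
    ∑ ψ : AddChar (Additive (RayGroup (modulus m))) ℂ, (ψ (Additive.ofMul k)).re * primeSum ψ s =
    ∑' 𝔭 : {𝔭 : Ideal (QuadOrder m) // Prime 𝔭},
      ∑ ψ : AddChar (Additive (RayGroup (modulus m))) ℂ,
        (ψ (Additive.ofMul k)).re * (idealChar ψ s 𝔭).re := by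
  have hsum : ∀ ψ : AddChar (Additive (RayGroup (modulus m))) ℂ,
      Summable fun 𝔭 : {𝔭 : Ideal (QuadOrder m) // Prime 𝔭} => idealChar ψ s 𝔭 := fun ψ =>
    ((summable_norm_idealChar ψ hs).of_norm).subtype _
  rw [Summable.tsum_finsetSum fun ψ _ => (Complex.hasSum_re (hsum ψ).hasSum).summable.mul_left _]
  refine Finset.sum_congr rfl fun ψ _ => ?_
  rw [tsum_mul_left, primeSum, Complex.re_tsum (hsum ψ)]

theorem sum_mul_idealChar (k : RayGroup (modulus m)) (a : coprimeIdeals (modulus m)) :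
    ∑ ψ : AddChar (Additive (RayGroup (modulus m))) ℂ,
      (ψ (Additive.ofMul k)).re * (idealChar ψ s (a : Ideal (QuadOrder m))).re =
    pairing k (cls a) * (Ideal.absNorm (a : Ideal (QuadOrder m)) : ℝ) ^ (-s) := by
  rw [pairing, Finset.sum_mul]
  refine Finset.sum_congr rfl fun ψ _ => ?_
  rw [idealChar_coe, Complex.re_mul_ofReal, mul_assoc]

end QuadOrder

namespace QuadOrder

open scoped QuadraticAlgebra
open RayClass

variable {m : ℤ} [h3 : Fact (3 ≤ m)] [hq : Fact (Prime (4 * m - 1))]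

theorem absNorm_span_natCast (n : ℕ) :
    Ideal.absNorm (Ideal.span {(n : QuadOrder m)}) = n ^ 2 := by
  have h := absNorm_span (n : QuadOrder m)
  rw [nm_eq, QuadraticAlgebra.re_natCast, QuadraticAlgebra.im_natCast] at h
  have : (Ideal.absNorm (Ideal.span {(n : QuadOrder m)}) : ℤ) = (n : ℤ) ^ 2 := by rw [h]; ring
  exact_mod_cast this

theorem exists_eq_span_of_not_prime {𝔭 : Ideal (QuadOrder m)} (h : Prime 𝔭)
    (hN : ¬ (Ideal.absNorm 𝔭).Prime) : ∃ n : ℕ, Ideal.span {(n : QuadOrder m)} = 𝔭 := by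
  have h2 := two_le_absNorm h
  have hprime : 𝔭.IsPrime := Ideal.isPrime_of_prime h
  obtain ⟨p, hp, hp𝔭⟩ : ∃ p : ℕ, p.Prime ∧ (p : QuadOrder m) ∈ 𝔭 := by
    have hmem := Ideal.absNorm_mem 𝔭
    rw [← Nat.prod_primeFactorsList (n := Ideal.absNorm 𝔭) (by omega), Nat.cast_list_prod,
      ← Multiset.prod_coe, hprime.multiset_prod_mem_iff_exists_mem] at hmem
    obtain ⟨_, hmem, h⟩ := hmem
    obtain ⟨p, hp, rfl⟩ := List.mem_map.1 (Multiset.mem_coe.1 hmem)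
    exact ⟨p, Nat.prime_of_mem_primeFactorsList hp, h⟩
  have hle : Ideal.span {(p : QuadOrder m)} ≤ 𝔭 := (Ideal.span_singleton_le_iff_mem _).2 hp𝔭
  have hdvd := Ideal.absNorm_dvd_absNorm_of_le hle
  rw [absNorm_span_natCast, Nat.dvd_prime_pow hp] at hdvd
  obtain ⟨i, hi, hi'⟩ := hdvd
  have hi2 : i = 2 := by
    interval_cases i
    · rw [pow_zero] at hi'; omega
    · rw [pow_one] at hi'; exact absurd (hi' ▸ hp) hN
    · rfl
  refine ⟨p, ?_⟩
  obtain ⟨c, hc⟩ := Ideal.dvd_iff_le.2 hle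
  have hN' := congrArg Ideal.absNorm hc
  rw [map_mul, absNorm_span_natCast, hi', hi2] at hN'
  have hc1 : Ideal.absNorm c = 1 :=
    (Nat.mul_right_cancel_iff (pow_pos hp.pos 2)).1 (by rw [one_mul, mul_comm]; exact hN'.symm)
  rw [hc, Ideal.absNorm_eq_one_iff.1 hc1, ← Ideal.one_eq_top, mul_one]

variable {ψ : AddChar (Additive (RayGroup (modulus m))) ℂ}

theorem exists_primeSum_zero : ∃ C : ℝ, ∀ᶠ s : ℝ in 𝓝[>] 1,
    |primeSum (0 : AddChar (Additive (RayGroup (modulus m))) ℂ) s + Real.log (s - 1)| ≤ C := by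
  obtain ⟨C, hC⟩ := exists_log_lSeries_zero (m := m)
  obtain ⟨D, hD⟩ := exists_primeSum_sub_log_le (m := m)
  refine ⟨C + D, ?_⟩
  filter_upwards [hC, self_mem_nhdsWithin] with s h hs
  have h' := hD 0 s hs
  rw [abs_le] at *
  constructor <;> linarith

theorem exists_primeSum_le (hψ : ψ ≠ 0) : ∃ C : ℝ, ∀ᶠ s : ℝ in 𝓝[>] 1, primeSum ψ s ≤ C := by
  obtain ⟨C, hC⟩ := exists_log_lSeries_le hψ fun s hs => lSeries_ne_zero hs
  obtain ⟨D, hD⟩ := exists_primeSum_sub_log_le (m := m)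
  refine ⟨C + D, ?_⟩
  filter_upwards [hC, self_mem_nhdsWithin] with s h hs
  linarith [(abs_le.1 (hD ψ s hs)).2]

theorem exists_primeSum_ge_or_le (hψ : ψ ≠ 0) :
    (∃ C : ℝ, ∀ᶠ s : ℝ in 𝓝[>] 1, C ≤ primeSum ψ s) ∨
      ∃ C : ℝ, ∀ᶠ s : ℝ in 𝓝[>] 1, primeSum ψ s ≤ C + Real.log (s - 1) := by
  obtain ⟨D, hD⟩ := exists_primeSum_sub_log_le (m := m)
  refine (exists_log_lSeries_ge_or_le hψ fun s hs => lSeries_ne_zero hs).imp ?_ ?_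
  · rintro ⟨C, hC⟩
    refine ⟨C - D, ?_⟩
    filter_upwards [hC, self_mem_nhdsWithin] with s h hs
    linarith [(abs_le.1 (hD ψ s hs)).1]
  · rintro ⟨C, hC⟩
    refine ⟨C + D, ?_⟩
    filter_upwards [hC, self_mem_nhdsWithin] with s h hs
    linarith [(abs_le.1 (hD ψ s hs)).2]

theorem idealChar_neg_coe (ψ : AddChar (Additive (RayGroup (modulus m))) ℂ) (s : ℝ)
    (a : coprimeIdeals (modulus m)) : idealChar (-ψ) s (a : Ideal (QuadOrder m)) =
      starRingEnd ℂ (idealChar ψ s (a : Ideal (QuadOrder m))) := by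
  rw [idealChar_coe, idealChar_coe, map_mul, Complex.conj_ofReal, AddChar.neg_apply,
    AddChar.map_neg_eq_conj]

theorem idealChar_neg (ψ : AddChar (Additive (RayGroup (modulus m))) ℂ) (s : ℝ)
    (a : Ideal (QuadOrder m)) : idealChar (-ψ) s a = starRingEnd ℂ (idealChar ψ s a) := by
  by_cases ha : a ∈ coprimeIdeals (modulus m)
  · exact idealChar_neg_coe ψ s ⟨a, ha⟩
  · rw [idealChar_of_notMem ha, idealChar_of_notMem ha, map_zero]

theorem primeSum_neg (ψ : AddChar (Additive (RayGroup (modulus m))) ℂ) (s : ℝ) :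
    primeSum (-ψ) s = primeSum ψ s := by
  have h : ∑' 𝔭 : {𝔭 : Ideal (QuadOrder m) // Prime 𝔭}, idealChar (-ψ) s 𝔭 =
      starRingEnd ℂ (∑' 𝔭 : {𝔭 : Ideal (QuadOrder m) // Prime 𝔭}, idealChar ψ s 𝔭) := by
    rw [Complex.conj_tsum]
    exact tsum_congr fun 𝔭 => idealChar_neg ψ s 𝔭
  rw [primeSum, h, Complex.conj_re, primeSum]

theorem neg_ne_self (hψ : ψ ≠ 0) : -ψ ≠ ψ := by
  intro h
  have hsurj : Function.Surjective fun x : RayGroup (modulus m) => x * x := by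
    refine Finite.surjective_of_injective fun x y hxy => ?_
    have hxy : x * x = y * y := hxy
    have h1 : (x / y) * (x / y) = 1 := by rw [div_mul_div_comm, hxy, div_self']
    exact div_eq_one.1 (eq_one_of_mul_self h1)
  refine hψ (AddChar.eq_zero_iff.2 fun a => ?_)
  obtain ⟨x, hx⟩ := hsurj a.toMul
  have hx : a = Additive.ofMul x + Additive.ofMul x := hx.symm
  have h1 : ψ (-Additive.ofMul x) = ψ (Additive.ofMul x) := by
    rw [← AddChar.neg_apply, h]
  rw [hx, AddChar.map_add_eq_mul]
  nth_rewrite 1 [← h1]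
  rw [← AddChar.map_add_eq_mul, neg_add_cancel, AddChar.map_zero_eq_one]

theorem tendsto_log_sub_one : Tendsto (fun s : ℝ => Real.log (s - 1)) (𝓝[>] 1) atBot := by
  refine Real.tendsto_log_nhdsGT_zero.comp (tendsto_nhdsWithin_iff.2 ⟨?_, ?_⟩)
  · refine Tendsto.mono_left ?_ nhdsWithin_le_nhds
    have : Continuous fun s : ℝ => s - 1 := by fun_prop
    simpa using this.tendsto 1
  · filter_upwards [self_mem_nhdsWithin] with s hs
    exact sub_pos.2 (Set.mem_Ioi.1 hs)

theorem sum_primeSum_nonneg {s : ℝ} (hs : 1 < s) :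
    0 ≤ ∑ ψ : AddChar (Additive (RayGroup (modulus m))) ℂ, primeSum ψ s := by
  have h := sum_mul_primeSum (1 : RayGroup (modulus m)) hs
  simp only [ofMul_one, AddChar.map_zero_eq_one, Complex.one_re, one_mul] at h
  rw [h]
  refine tsum_nonneg fun 𝔭 => ?_
  by_cases h𝔭 : (𝔭 : Ideal (QuadOrder m)) ∈ coprimeIdeals (modulus m)
  · have h' := sum_mul_idealChar (s := s) (1 : RayGroup (modulus m)) ⟨𝔭, h𝔭⟩
    simp only [ofMul_one, AddChar.map_zero_eq_one, Complex.one_re, one_mul] at h'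
    rw [h']
    exact mul_nonneg (pairing_nonneg _ _) (Real.rpow_nonneg (Nat.cast_nonneg _) _)
  · exact Finset.sum_nonneg fun ψ _ => by rw [idealChar_of_notMem h𝔭, Complex.zero_re]

/-- The `L`-series of a nontrivial ray class character does not vanish at `1`. -/
theorem exists_le_primeSum (hψ : ψ ≠ 0) : ∃ C : ℝ, ∀ᶠ s : ℝ in 𝓝[>] 1, C ≤ primeSum ψ s := by
  classical
  refine (exists_primeSum_ge_or_le hψ).resolve_right ?_
  rintro ⟨C₁, hC₁⟩
  let e : AddChar (Additive (RayGroup (modulus m))) ℂ → ℝ := fun χ =>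
    (if χ = ψ then 1 else 0) + (if χ = -ψ then 1 else 0) - (if χ = 0 then 1 else 0)
  have hsum : ∑ χ, e χ = 1 := by
    simp [e, Finset.sum_add_distrib, Finset.sum_sub_distrib]
  have hψ' : -ψ ≠ ψ := neg_ne_self hψ
  have hψ0 : -ψ ≠ 0 := neg_ne_zero.2 hψ
  have hex : ∀ χ, ∃ C : ℝ, ∀ᶠ s : ℝ in 𝓝[>] 1, primeSum χ s ≤ C + e χ * Real.log (s - 1) := by
    intro χ
    by_cases h1 : χ = ψ
    · exact ⟨C₁, by simpa [e, h1, hψ, hψ'.symm] using hC₁⟩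
    by_cases h2 : χ = -ψ
    · exact ⟨C₁, by simpa [e, h2, hψ, hψ', primeSum_neg] using hC₁⟩
    by_cases h4 : χ = 0
    · obtain ⟨C, hC⟩ := exists_primeSum_zero (m := m)
      refine ⟨C, hC.mono fun s hs => ?_⟩
      have he : e χ = -1 := by
        subst h4
        simp [e, hψ.symm, hψ0.symm]
      rw [he, h4]
      linarith [(abs_le.1 hs).2]
    · obtain ⟨C, hC⟩ := exists_primeSum_le h4
      exact ⟨C, by simpa [e, h1, h2, h4] using hC⟩
  choose C hC using hex
  have hlim := tendsto_log_sub_one.eventually (eventually_lt_atBot (-∑ χ, C χ))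
  obtain ⟨s, hs, hs1, hs2⟩ := ((eventually_all.2 hC).and (hlim.and self_mem_nhdsWithin)).exists
  have h := (sum_primeSum_nonneg (m := m) hs2).trans (Finset.sum_le_sum fun χ _ => hs χ)
  rw [Finset.sum_add_distrib, ← Finset.sum_mul, hsum] at h
  linarith

theorem exists_le_sum_mul_primeSum (k : RayGroup (modulus m)) :
    ∃ C : ℝ, ∀ᶠ s : ℝ in 𝓝[>] 1, C - Real.log (s - 1) ≤
      ∑ ψ : AddChar (Additive (RayGroup (modulus m))) ℂ,
        (ψ (Additive.ofMul k)).re * primeSum ψ s := by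
  classical
  have hex : ∀ χ : AddChar (Additive (RayGroup (modulus m))) ℂ, ∃ C : ℝ, ∀ᶠ s : ℝ in 𝓝[>] 1,
      C - (if χ = 0 then 1 else 0) * Real.log (s - 1) ≤
        (χ (Additive.ofMul k)).re * primeSum χ s := by
    intro χ
    by_cases h : χ = 0
    · obtain ⟨C, hC⟩ := exists_primeSum_zero (m := m)
      refine ⟨-C, hC.mono fun s hs => ?_⟩
      rw [if_pos h, h, AddChar.zero_apply, Complex.one_re]
      linarith [(abs_le.1 hs).1]
    · obtain ⟨B, hB⟩ := exists_le_primeSum h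
      obtain ⟨D, hD⟩ := exists_primeSum_le h
      refine ⟨-max |B| |D|, (hB.and hD).mono fun s hs => ?_⟩
      rw [if_neg h, zero_mul, sub_zero]
      have h1 : |primeSum χ s| ≤ max |B| |D| := abs_le_max_abs_abs hs.1 hs.2
      have h2 : |(χ (Additive.ofMul k)).re| ≤ 1 :=
        (Complex.abs_re_le_norm _).trans (AddChar.norm_apply _ _).le
      have h4 : |(χ (Additive.ofMul k)).re * primeSum χ s| ≤ max |B| |D| := by
        rw [abs_mul]
        exact (mul_le_of_le_one_left (abs_nonneg _) h2).trans h1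
      exact (abs_le.1 h4).1
  choose C hC using hex
  refine ⟨∑ χ, C χ, (eventually_all.2 hC).mono fun s hs => ?_⟩
  have h := Finset.sum_le_sum fun χ (_ : χ ∈ Finset.univ) => hs χ
  rw [Finset.sum_sub_distrib, ← Finset.sum_mul] at h
  simpa using h

theorem summable_span_natCast : Summable fun a : Ideal (QuadOrder m) =>
    Set.indicator (Set.range fun n : ℕ => Ideal.span {(n : QuadOrder m)})
      (fun a => (Ideal.absNorm a : ℝ)⁻¹) a := by
  have hinj : Function.Injective fun n : ℕ => Ideal.span {(n : QuadOrder m)} := fun a b hab => by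
    have h := congrArg Ideal.absNorm hab
    simp only [absNorm_span_natCast] at h
    exact Nat.pow_left_injective (n := 2) (by norm_num) h
  rw [← hinj.summable_iff fun a ha => Set.indicator_of_notMem ha _]
  refine (Real.summable_nat_pow_inv.2 (by norm_num : 1 < 2)).congr fun n => ?_
  rw [Function.comp, Set.indicator_of_mem (Set.mem_range_self n), absNorm_span_natCast,
    Nat.cast_pow]

theorem exists_cls_eq_or (k : RayGroup (modulus m)) : ∃ a : coprimeIdeals (modulus m),
    (Ideal.absNorm (a : Ideal (QuadOrder m))).Prime ∧ (cls a = k ∨ cls a = k⁻¹) := by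
  by_contra! hcon
  set G := fun a : Ideal (QuadOrder m) =>
    Set.indicator (Set.range fun n : ℕ => Ideal.span {(n : QuadOrder m)})
      (fun a => (Ideal.absNorm a : ℝ)⁻¹) a with hG
  have hG0 : ∀ a, 0 ≤ G a := fun a => Set.indicator_nonneg (fun _ _ => by positivity) a
  set D := ∑ c, pairing k c with hD
  have hGs : Summable fun 𝔭 : {𝔭 : Ideal (QuadOrder m) // Prime 𝔭} => D * G 𝔭 :=
    (summable_span_natCast.subtype _).mul_left D
  have hD0 : 0 ≤ D := Finset.sum_nonneg fun c _ => pairing_nonneg k c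
  have hbd : ∀ s : ℝ, 1 < s → ∀ 𝔭 : {𝔭 : Ideal (QuadOrder m) // Prime 𝔭},
      ∑ ψ : AddChar (Additive (RayGroup (modulus m))) ℂ,
        (ψ (Additive.ofMul k)).re * (idealChar ψ s 𝔭).re ≤ D * G 𝔭 := by
    rintro s hs ⟨𝔭, h𝔭⟩
    by_cases ha : 𝔭 ∈ coprimeIdeals (modulus m)
    · refine (sum_mul_idealChar k ⟨𝔭, ha⟩).trans_le ?_
      by_cases hN : (Ideal.absNorm 𝔭).Prime
      · rw [pairing_eq_zero (hcon ⟨𝔭, ha⟩ hN).1 (hcon ⟨𝔭, ha⟩ hN).2, zero_mul]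
        exact mul_nonneg hD0 (hG0 _)
      · have hmem : 𝔭 ∈ Set.range fun n : ℕ => Ideal.span {(n : QuadOrder m)} :=
          exists_eq_span_of_not_prime h𝔭 hN
        have h1 : (Ideal.absNorm 𝔭 : ℝ) ^ (-s) ≤ (Ideal.absNorm 𝔭 : ℝ)⁻¹ := by
          have := norm_idealChar_le_inv 0 hs h𝔭
          rwa [norm_idealChar_of_mem 0 s ha] at this
        have h2 : pairing k (cls ⟨𝔭, ha⟩) ≤ D :=
          Finset.single_le_sum (f := pairing k) (fun c _ => pairing_nonneg k c)
            (Finset.mem_univ _)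
        simp only [hG, Set.indicator_of_mem hmem]
        exact mul_le_mul h2 h1 (Real.rpow_nonneg (Nat.cast_nonneg _) _) hD0
    · refine le_trans (Finset.sum_eq_zero fun ψ _ => ?_).le (mul_nonneg hD0 (hG0 _))
      rw [idealChar_of_notMem ha, Complex.zero_re, mul_zero]
  obtain ⟨C, hC⟩ := exists_le_sum_mul_primeSum k
  have hlim := tendsto_log_sub_one.eventually (eventually_lt_atBot
    (C - ∑' 𝔭 : {𝔭 : Ideal (QuadOrder m) // Prime 𝔭}, D * G 𝔭))
  obtain ⟨s, h1, h2, hs⟩ := (hC.and (hlim.and self_mem_nhdsWithin)).exists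
  rw [sum_mul_primeSum k hs] at h1
  have h4 := h1.trans (tsum_le_of_sum_le'
    (tsum_nonneg fun 𝔭 => mul_nonneg hD0 (hG0 _)) fun T =>
      (Finset.sum_le_sum fun 𝔭 _ => hbd s hs 𝔭).trans
        (hGs.sum_le_tsum T fun 𝔭 _ => mul_nonneg hD0 (hG0 _)))
  linarith

end QuadOrder

/-- For every Sophie Germain prime `g ≥ 5` there exist a prime `p` and integers `x, y`
such that `p = x² + (2g+1)y²`, `p ≠ 2g+1`, and `p ≢ 1 (mod 2g+1)`. -/
theorem stmt_0 (g : ℕ) (hg5 : 5 ≤ g) (hg : Nat.Prime g) (hsg : Nat.Prime (2 * g + 1)) :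
    ∃ p : ℕ, p.Prime ∧ (∃ x y : ℤ, (p : ℤ) = x ^ 2 + (2 * g + 1) * y ^ 2) ∧
      p ≠ 2 * g + 1 ∧ p % (2 * g + 1) ≠ 1 := by
  obtain ⟨n, hn⟩ : Odd g := hg.odd_of_ne_two (by omega)
  have hm : 4 * ((n : ℤ) + 1) - 1 = 2 * g + 1 := by rw [hn]; push_cast; ring
  have : Fact (3 ≤ (n : ℤ) + 1) := ⟨by omega⟩
  have : Fact (Prime (4 * ((n : ℤ) + 1) - 1)) :=
    ⟨by rw [hm]; exact_mod_cast Nat.prime_iff_prime_int.1 hsg⟩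
  obtain ⟨p, hp, hxy, h1, h2⟩ := QuadOrder.exists_prime_of_forall_cls
    (m := (n : ℤ) + 1) QuadOrder.exists_cls_eq_or
  rw [hm] at hxy h1 h2
  refine ⟨p, hp, hxy, fun h => h1 ⟨1, by rw [h]; push_cast; ring⟩, fun h => h2 ?_⟩
  refine ⟨((p / (2 * g + 1) : ℕ) : ℤ), ?_⟩
  have h4 := Nat.div_add_mod p (2 * g + 1)
  rw [h] at h4
  have h5 : ((2 * g + 1) * ((p / (2 * g + 1) : ℕ) : ℤ) + 1 : ℤ) = p := by exact_mod_cast h4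
  linarith
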